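/- arXiv:2407.18259 — 3 statements merged into one kernel-verified Lean document; each statement's English description precedes it below -/
import Mathlib

section
/- For every positive integer n, the number r_6(n) of representations of n as a sum of six squares of integers satisfies the identity r_6(n) = 16·∑_{d|n} χ(d)·(n/d)^2 − 4·∑_{d|n} χ(d)·d^2, where χ is the nonprincipal Dirichlet character modulo 4. -/
/-- `r6 n` is the number of tuples `(a₁, …, a₆) ∈ ℤ⁶` with `a₁² + ⋯ + a₆² = n`. -/
noncomputable def r6 (n : ℕ) : ℕ :=
  Nat.card {v : Fin 6 → ℤ // ∑ i, (v i) ^ 2 = (n : ℤ)}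

/-- The nonprincipal Dirichlet character modulo 4, as a function `ℕ → ℤ`. -/
def chi4 (d : ℕ) : ℤ :=
  if d % 4 = 1 then 1 else if d % 4 = 3 then -1 else 0

/-- The nonprincipal Dirichlet character modulo 4 on the integers. -/
def chiInt (m : ℤ) : ℤ :=
  if m % 4 = 1 then 1 else if m % 4 = 3 then -1 else 0

lemma chiInt_natCast (d : ℕ) : chiInt d = chi4 d := by
  unfold chiInt chi4
  split_ifs <;> first | rfl | omega

lemma chiInt_of_even {m : ℤ} (h : m % 2 = 0) : chiInt m = 0 := by
  unfold chiInt
  split_ifs <;> first | rfl | omega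

/-- The pairs of positive integers with product `m`. -/
noncomputable def factorPairs (m : ℤ) : Finset (ℤ × ℤ) :=
  (Finset.Icc 1 m ×ˢ Finset.Icc 1 m).filter fun p => p.1 * p.2 = m

lemma mem_factorPairs {m : ℤ} {p : ℤ × ℤ} :
    p ∈ factorPairs m ↔ 0 < p.1 ∧ 0 < p.2 ∧ p.1 * p.2 = m := by
  simp only [factorPairs, Finset.mem_filter, Finset.mem_product, Finset.mem_Icc]
  constructor
  · rintro ⟨⟨⟨h1, h2⟩, h3, h4⟩, h⟩
    exact ⟨by omega, by omega, h⟩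
  · rintro ⟨h1, h2, h⟩
    refine ⟨⟨⟨by omega, ?_⟩, by omega, ?_⟩, h⟩ <;> nlinarith

/-- The triples `(u, d, e)` with `d, e` positive and `u ^ 2 + d * e = n`. -/
noncomputable def liouvilleTriples (n : ℤ) : Finset (ℤ × ℤ × ℤ) :=
  (Finset.Icc (-n) n ×ˢ Finset.Icc 1 n ×ˢ Finset.Icc 1 n).filter
    fun t => t.1 ^ 2 + t.2.1 * t.2.2 = n

lemma abs_le_of_sq_le {u n : ℤ} (h : u ^ 2 ≤ n) : -n ≤ u ∧ u ≤ n := by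
  constructor <;> nlinarith [sq_nonneg (u - 1), sq_nonneg (u + 1), Int.le_self_sq u,
    Int.le_self_sq (-u)]

lemma mem_liouvilleTriples {n : ℤ} {t : ℤ × ℤ × ℤ} :
    t ∈ liouvilleTriples n ↔ 0 < t.2.1 ∧ 0 < t.2.2 ∧ t.1 ^ 2 + t.2.1 * t.2.2 = n := by
  obtain ⟨u, d, e⟩ := t
  simp only [liouvilleTriples, Finset.mem_filter, Finset.mem_product, Finset.mem_Icc]
  constructor
  · rintro ⟨⟨-, ⟨h1, -⟩, h2, -⟩, h⟩
    exact ⟨by omega, by omega, h⟩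
  · rintro ⟨h1, h2, h⟩
    have hde : 0 < d * e := mul_pos h1 h2
    refine ⟨⟨abs_le_of_sq_le (by omega), ⟨by omega, ?_⟩, by omega, ?_⟩, h⟩ <;>
      nlinarith [sq_nonneg u]

lemma sum_liouvilleTriples_neg (n : ℤ) (f : ℤ → ℤ → ℤ → ℤ) :
    ∑ t ∈ liouvilleTriples n, f (-t.1) t.2.1 t.2.2 =
      ∑ t ∈ liouvilleTriples n, f t.1 t.2.1 t.2.2 := by
  refine Finset.sum_nbij' (fun t => (-t.1, t.2.1, t.2.2)) (fun t => (-t.1, t.2.1, t.2.2))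
    ?_ ?_ ?_ ?_ ?_ <;> simp [mem_liouvilleTriples]

lemma sum_liouvilleTriples_swap (n : ℤ) (f : ℤ → ℤ → ℤ → ℤ) :
    ∑ t ∈ liouvilleTriples n, f t.1 t.2.2 t.2.1 =
      ∑ t ∈ liouvilleTriples n, f t.1 t.2.1 t.2.2 := by
  refine Finset.sum_nbij' (fun t => (t.1, t.2.2, t.2.1)) (fun t => (t.1, t.2.2, t.2.1))
    ?_ ?_ ?_ ?_ ?_ <;> simp +contextual [mem_liouvilleTriples, mul_comm]

section Liouville

variable {F : ℤ → ℤ → ℤ → ℤ}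

lemma sum_liouville_pos (hodd : ∀ x y z, F (-x) y z = -F x y z) (n : ℤ) :
    ∑ t ∈ (liouvilleTriples n).filter (fun t => 0 < 2 * t.1 + t.2.1 - t.2.2),
      F (t.2.2 - 2 * t.1) (t.1 + t.2.1) (2 * t.1 + 2 * t.2.1 - t.2.2) = 0 := by
  have key : ∑ t ∈ (liouvilleTriples n).filter (fun t => 0 < 2 * t.1 + t.2.1 - t.2.2),
      F (t.2.2 - 2 * t.1) (t.1 + t.2.1) (2 * t.1 + 2 * t.2.1 - t.2.2) =
      ∑ t ∈ (liouvilleTriples n).filter (fun t => 0 < 2 * t.1 + t.2.1 - t.2.2),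
      -F (t.2.2 - 2 * t.1) (t.1 + t.2.1) (2 * t.1 + 2 * t.2.1 - t.2.2) := by
    refine Finset.sum_nbij' (fun t => (t.2.2 - t.1, 2 * t.1 + t.2.1 - t.2.2, t.2.2))
      (fun t => (t.2.2 - t.1, 2 * t.1 + t.2.1 - t.2.2, t.2.2)) ?_ ?_ ?_ ?_ ?_
    · rintro ⟨u, d, e⟩ h
      simp only [Finset.mem_filter, mem_liouvilleTriples] at h ⊢
      refine ⟨⟨by omega, by omega, ?_⟩, by omega⟩
      linear_combination h.1.2.2
    · rintro ⟨u, d, e⟩ h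
      simp only [Finset.mem_filter, mem_liouvilleTriples] at h ⊢
      refine ⟨⟨by omega, by omega, ?_⟩, by omega⟩
      linear_combination h.1.2.2
    · rintro ⟨u, d, e⟩ -
      ext <;> dsimp only <;> ring
    · rintro ⟨u, d, e⟩ -
      ext <;> dsimp only <;> ring
    · rintro ⟨u, d, e⟩ -
      rw [← hodd]
      congr 1 <;> dsimp only <;> ring
  rw [Finset.sum_neg_distrib] at key
  omega

lemma sum_liouville_neg (n : ℤ) :
    ∑ t ∈ (liouvilleTriples n).filter (fun t => 2 * t.1 + t.2.1 - t.2.2 < 0),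
      F (t.2.2 - 2 * t.1) (t.1 + t.2.1) (2 * t.1 + 2 * t.2.1 - t.2.2) =
    ∑ t ∈ (liouvilleTriples n).filter (fun t => 0 < 2 * t.1 + t.2.2 - t.2.1),
      F (t.2.1 + t.2.2) t.1 (t.2.1 - t.2.2) := by
  refine Finset.sum_nbij' (fun t => (t.1 + t.2.1, t.2.1, t.2.2 - 2 * t.1 - t.2.1))
    (fun t => (t.1 - t.2.1, t.2.1, t.2.2 + 2 * t.1 - t.2.1)) ?_ ?_ ?_ ?_ ?_
  · rintro ⟨u, d, e⟩ h
    simp only [Finset.mem_filter, mem_liouvilleTriples] at h ⊢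
    refine ⟨⟨by omega, by omega, ?_⟩, by omega⟩
    linear_combination h.1.2.2
  · rintro ⟨u, d, e⟩ h
    simp only [Finset.mem_filter, mem_liouvilleTriples] at h ⊢
    refine ⟨⟨by omega, by omega, ?_⟩, by omega⟩
    linear_combination h.1.2.2
  · rintro ⟨u, d, e⟩ -
    ext <;> dsimp only <;> ring
  · rintro ⟨u, d, e⟩ -
    ext <;> dsimp only <;> ring
  · rintro ⟨u, d, e⟩ -
    congr 1 <;> dsimp only <;> ring

lemma sum_liouville_reflect (heven : ∀ x y z, F x (-y) (-z) = F x y z) (n : ℤ) :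
    ∑ t ∈ (liouvilleTriples n).filter (fun t => 2 * t.1 + t.2.2 - t.2.1 < 0),
      F (t.2.1 + t.2.2) t.1 (t.2.1 - t.2.2) =
    ∑ t ∈ (liouvilleTriples n).filter (fun t => 0 < 2 * t.1 + t.2.2 - t.2.1),
      F (t.2.1 + t.2.2) t.1 (t.2.1 - t.2.2) := by
  refine Finset.sum_nbij' (fun t => (-t.1, t.2.2, t.2.1)) (fun t => (-t.1, t.2.2, t.2.1))
    ?_ ?_ ?_ ?_ ?_
  · rintro ⟨u, d, e⟩ h
    simp only [Finset.mem_filter, mem_liouvilleTriples] at h ⊢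
    refine ⟨⟨by omega, by omega, ?_⟩, by omega⟩
    linear_combination h.1.2.2
  · rintro ⟨u, d, e⟩ h
    simp only [Finset.mem_filter, mem_liouvilleTriples] at h ⊢
    refine ⟨⟨by omega, by omega, ?_⟩, by omega⟩
    linear_combination h.1.2.2
  · simp
  · simp
  · rintro ⟨u, d, e⟩ -
    rw [← heven]
    congr 1 <;> dsimp only <;> ring

lemma sum_filter_trichotomy (s : Finset (ℤ × ℤ × ℤ)) (g f : ℤ × ℤ × ℤ → ℤ) :
    ∑ t ∈ s, f t = ∑ t ∈ s.filter (fun t => 0 < g t), f t + ∑ t ∈ s.filter (fun t => g t < 0), f t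
      + ∑ t ∈ s.filter (fun t => g t = 0), f t := by
  simp only [Finset.sum_filter, ← Finset.sum_add_distrib]
  refine Finset.sum_congr rfl fun t _ => ?_
  rcases lt_trichotomy (g t) 0 with h | h | h
  · simp [h, h.ne, h.le]
  · simp [h]
  · simp [h, h.ne', h.le]

/-- Liouville's identity, with the boundary terms left as sums over triples. -/
lemma liouville_identity (hodd : ∀ x y z, F (-x) y z = -F x y z)
    (heven : ∀ x y z, F x (-y) (-z) = F x y z) (n : ℤ) :
    2 * ∑ t ∈ liouvilleTriples n,
        F (t.2.2 - 2 * t.1) (t.1 + t.2.1) (2 * t.1 + 2 * t.2.1 - t.2.2) =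
      ∑ t ∈ liouvilleTriples n, F (t.2.1 + t.2.2) t.1 (t.2.1 - t.2.2)
      + 2 * ∑ t ∈ (liouvilleTriples n).filter (fun t => 2 * t.1 + t.2.1 - t.2.2 = 0),
          F (t.2.2 - 2 * t.1) (t.1 + t.2.1) (2 * t.1 + 2 * t.2.1 - t.2.2)
      - ∑ t ∈ (liouvilleTriples n).filter (fun t => 2 * t.1 + t.2.2 - t.2.1 = 0),
          F (t.2.1 + t.2.2) t.1 (t.2.1 - t.2.2) := by
  rw [sum_filter_trichotomy (liouvilleTriples n) (fun t => 2 * t.1 + t.2.1 - t.2.2),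
    sum_filter_trichotomy (liouvilleTriples n) (fun t => 2 * t.1 + t.2.2 - t.2.1),
    sum_liouville_pos hodd, sum_liouville_neg, sum_liouville_reflect heven]
  ring

end Liouville

/-- The test function to which Liouville's identity is applied. -/
def sixSquaresTest (x y z : ℤ) : ℤ :=
  if x % 2 = 0 ∧ z % 2 = 0 then
    chiInt (x / 2 + z / 2) *
      if x / 2 % 2 = 1 then
        -3 * ((x / 2) ^ 2 + (z / 2) ^ 2) * ((x / 2) ^ 2 - (z / 2) ^ 2 - 6 * y ^ 2)
          - y * (z / 2) * (15 * (x / 2) ^ 2 + 13 * (z / 2) ^ 2 + 8 * y ^ 2)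
      else
        10 * (x / 2) * (z / 2) * ((x / 2) ^ 2 - (z / 2) ^ 2 - 6 * y ^ 2)
          + (x / 2) * y * (-9 * (x / 2) ^ 2 + 45 * (z / 2) ^ 2 + 24 * y ^ 2)
  else 0

lemma sixSquaresTest_two_mul (a y b : ℤ) :
    sixSquaresTest (2 * a) y (2 * b) = chiInt (a + b) *
      if a % 2 = 1 then
        -3 * (a ^ 2 + b ^ 2) * (a ^ 2 - b ^ 2 - 6 * y ^ 2)
          - y * b * (15 * a ^ 2 + 13 * b ^ 2 + 8 * y ^ 2)
      else
        10 * a * b * (a ^ 2 - b ^ 2 - 6 * y ^ 2)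
          + a * y * (-9 * a ^ 2 + 45 * b ^ 2 + 24 * y ^ 2) := by
  simp [sixSquaresTest]

lemma sixSquaresTest_of_odd {x z : ℤ} (y : ℤ) (h : ¬ (x % 2 = 0 ∧ z % 2 = 0)) :
    sixSquaresTest x y z = 0 := if_neg h

lemma chiInt_neg (a : ℤ) : chiInt (-a) = -chiInt a := by
  unfold chiInt
  split_ifs <;> first | rfl | omega

lemma chiInt_sub_of_odd {a b : ℤ} (ha : a % 2 = 1) : chiInt (a - b) = chiInt (a + b) := by
  unfold chiInt
  split_ifs <;> first | rfl | omega

lemma chiInt_sub_of_even {a b : ℤ} (ha : a % 2 = 0) : chiInt (a - b) = -chiInt (a + b) := by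
  unfold chiInt
  split_ifs <;> first | rfl | omega

lemma sixSquaresTest_neg_left (x y z : ℤ) : sixSquaresTest (-x) y z = -sixSquaresTest x y z := by
  by_cases h : x % 2 = 0 ∧ z % 2 = 0
  · obtain ⟨a, rfl⟩ : ∃ a, x = 2 * a := ⟨x / 2, by omega⟩
    obtain ⟨b, rfl⟩ : ∃ b, z = 2 * b := ⟨z / 2, by omega⟩
    rw [show -(2 * a) = 2 * (-a) by ring, sixSquaresTest_two_mul, sixSquaresTest_two_mul,
      show -a + b = -(a - b) by ring, chiInt_neg]
    rcases Int.emod_two_eq_zero_or_one a with ha | ha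
    · rw [chiInt_sub_of_even ha, if_neg (by omega), if_neg (by omega)]
      ring
    · rw [chiInt_sub_of_odd ha, if_pos (by omega), if_pos (by omega)]
      ring
  · rw [sixSquaresTest_of_odd _ h, sixSquaresTest_of_odd _ (by omega), neg_zero]

lemma sixSquaresTest_neg_right (x y z : ℤ) :
    sixSquaresTest x (-y) (-z) = sixSquaresTest x y z := by
  by_cases h : x % 2 = 0 ∧ z % 2 = 0
  · obtain ⟨a, rfl⟩ : ∃ a, x = 2 * a := ⟨x / 2, by omega⟩
    obtain ⟨b, rfl⟩ : ∃ b, z = 2 * b := ⟨z / 2, by omega⟩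
    rw [show -(2 * b) = 2 * (-b) by ring, sixSquaresTest_two_mul, sixSquaresTest_two_mul,
      ← sub_eq_add_neg]
    rcases Int.emod_two_eq_zero_or_one a with ha | ha
    · rw [chiInt_sub_of_even ha, if_neg (by omega), if_neg (by omega)]
      ring
    · rw [chiInt_sub_of_odd ha, if_pos (by omega), if_pos (by omega)]
      ring
  · rw [sixSquaresTest_of_odd _ h, sixSquaresTest_of_odd _ (by omega)]

/-- The summand of the recursion for the divisor sum, corrected by the two
test sums of Liouville's identity. -/
def sixSquaresDefect (u d e : ℤ) : ℤ :=
  (d * e - 6 * u ^ 2) * (4 * e ^ 2 - d ^ 2) * chiInt d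
    - 2 * sixSquaresTest (e - 2 * u) (u + d) (2 * u + 2 * d - e)
    + sixSquaresTest (d + e) u (d - e)

lemma sixSquaresDefect_even {d e : ℤ} (u : ℤ) (he : e % 2 = 0) :
    sixSquaresDefect u d e + sixSquaresDefect (-u) d e = 0 := by
  obtain ⟨k, rfl⟩ : ∃ k, e = 2 * k := ⟨e / 2, by omega⟩
  unfold sixSquaresDefect
  rcases Int.emod_two_eq_zero_or_one d with hd | hd
  · obtain ⟨l, rfl⟩ : ∃ l, d = 2 * l := ⟨d / 2, by omega⟩
    rw [show 2 * k - 2 * u = 2 * (k - u) by ring, show 2 * k - 2 * -u = 2 * (k + u) by ring,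
      show 2 * u + 2 * (2 * l) - 2 * k = 2 * (u + 2 * l - k) by ring,
      show 2 * -u + 2 * (2 * l) - 2 * k = 2 * (- u + 2 * l - k) by ring,
      show 2 * l + 2 * k = 2 * (l + k) by ring, show 2 * l - 2 * k = 2 * (l - k) by ring]
    simp only [sixSquaresTest_two_mul]
    rw [chiInt_of_even (m := 2 * l) (by omega), chiInt_of_even (m := l + k + (l - k)) (by omega),
      chiInt_of_even (m := k - u + (u + 2 * l - k)) (by omega),
      chiInt_of_even (m := k + u + (-u + 2 * l - k)) (by omega)]
    ring
  · rw [sixSquaresTest_of_odd (x := d + 2 * k) _ (by omega),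
      sixSquaresTest_of_odd (x := d + 2 * k) _ (by omega),
      show 2 * k - 2 * u = 2 * (k - u) by ring, show 2 * k - 2 * -u = 2 * (k + u) by ring,
      show 2 * u + 2 * d - 2 * k = 2 * (u + d - k) by ring,
      show 2 * -u + 2 * d - 2 * k = 2 * (- u + d - k) by ring,
      sixSquaresTest_two_mul, sixSquaresTest_two_mul,
      show k - u + (u + d - k) = d by ring, show k + u + (-u + d - k) = d by ring]
    rcases Int.emod_two_eq_zero_or_one (k - u) with h | h
    · rw [if_neg (by omega), if_neg (by omega)]
      ring
    · rw [if_pos (by omega), if_pos (by omega)]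
      ring

lemma sixSquaresDefect_odd {d e : ℤ} (u : ℤ) (he : e % 2 = 1) (hd : d % 2 = 1) :
    sixSquaresDefect u d e + sixSquaresDefect (-u) d e
      + (sixSquaresDefect u e d + sixSquaresDefect (-u) e d) = 0 := by
  obtain ⟨a, ha⟩ : ∃ a, d + e = 2 * a := ⟨(d + e) / 2, by omega⟩
  obtain ⟨b, hb⟩ : ∃ b, d - e = 2 * b := ⟨(d - e) / 2, by omega⟩
  obtain rfl : d = a + b := by omega
  obtain rfl : e = a - b := by omega
  unfold sixSquaresDefect
  repeat rw [sixSquaresTest_of_odd (x := _ - 2 * _) _ (by omega)]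
  rw [ha, hb, show a - b + (a + b) = 2 * a by ring, show a - b - (a + b) = 2 * (-b) by ring]
  simp only [sixSquaresTest_two_mul, ← sub_eq_add_neg]
  rcases Int.emod_two_eq_zero_or_one a with h | h
  · rw [chiInt_sub_of_even h]
    simp only [if_neg (show ¬ a % 2 = 1 by omega)]
    ring
  · rw [chiInt_sub_of_odd h]
    simp only [if_pos h]
    ring

lemma sixSquaresDefect_of_even_odd {d e : ℤ} (u : ℤ) (he : e % 2 = 1) (hd : d % 2 = 0) :
    sixSquaresDefect u d e = 0 := by
  unfold sixSquaresDefect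
  rw [chiInt_of_even hd, sixSquaresTest_of_odd _ (by omega), sixSquaresTest_of_odd _ (by omega)]
  ring

lemma sum_sixSquaresDefect (n : ℤ) :
    ∑ t ∈ liouvilleTriples n, sixSquaresDefect t.1 t.2.1 t.2.2 = 0 := by
  have hE := sum_liouvilleTriples_neg n
    (fun u d e => if e % 2 = 0 then sixSquaresDefect u d e else 0)
  have hO := sum_liouvilleTriples_neg n
    (fun u d e => if e % 2 = 1 ∧ d % 2 = 1 then sixSquaresDefect u d e else 0)
  have hS := sum_liouvilleTriples_swap n
    (fun u d e => if e % 2 = 1 ∧ d % 2 = 1 then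
      sixSquaresDefect u d e + sixSquaresDefect (-u) d e else 0)
  have h1 : ∑ t ∈ liouvilleTriples n,
      (if t.2.2 % 2 = 0 then sixSquaresDefect t.1 t.2.1 t.2.2 else 0) = 0 := by
    have : ∑ t ∈ liouvilleTriples n,
        ((if t.2.2 % 2 = 0 then sixSquaresDefect t.1 t.2.1 t.2.2 else 0) +
        if t.2.2 % 2 = 0 then sixSquaresDefect (-t.1) t.2.1 t.2.2 else 0) = 0 := by
      refine Finset.sum_eq_zero fun t _ => ?_
      split_ifs with h
      · exact sixSquaresDefect_even _ h
      · rfl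
    rw [Finset.sum_add_distrib] at this
    omega
  have h2 : ∑ t ∈ liouvilleTriples n, (if t.2.2 % 2 = 1 ∧ t.2.1 % 2 = 1 then
      sixSquaresDefect t.1 t.2.1 t.2.2 else 0) = 0 := by
    have h3 : ∑ t ∈ liouvilleTriples n, (if t.2.2 % 2 = 1 ∧ t.2.1 % 2 = 1 then
        sixSquaresDefect t.1 t.2.1 t.2.2 + sixSquaresDefect (-t.1) t.2.1 t.2.2 else 0) =
        ∑ t ∈ liouvilleTriples n, (if t.2.2 % 2 = 1 ∧ t.2.1 % 2 = 1 then
          sixSquaresDefect t.1 t.2.1 t.2.2 else 0) +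
        ∑ t ∈ liouvilleTriples n, (if t.2.2 % 2 = 1 ∧ t.2.1 % 2 = 1 then
          sixSquaresDefect (-t.1) t.2.1 t.2.2 else 0) := by
      rw [← Finset.sum_add_distrib]
      refine Finset.sum_congr rfl fun t _ => ?_
      split_ifs <;> simp
    have h4 : ∑ t ∈ liouvilleTriples n, ((if t.2.2 % 2 = 1 ∧ t.2.1 % 2 = 1 then
        sixSquaresDefect t.1 t.2.1 t.2.2 + sixSquaresDefect (-t.1) t.2.1 t.2.2 else 0) +
        if t.2.1 % 2 = 1 ∧ t.2.2 % 2 = 1 then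
        sixSquaresDefect t.1 t.2.2 t.2.1 + sixSquaresDefect (-t.1) t.2.2 t.2.1 else 0) = 0 := by
      refine Finset.sum_eq_zero fun t _ => ?_
      by_cases h : t.2.2 % 2 = 1 ∧ t.2.1 % 2 = 1
      · rw [if_pos h, if_pos h.symm]
        exact sixSquaresDefect_odd _ h.1 h.2
      · rw [if_neg h, if_neg fun h' => h h'.symm, add_zero]
    rw [Finset.sum_add_distrib] at h4
    omega
  have h12 := congr_arg₂ (· + ·) h1 h2
  simp only [← Finset.sum_add_distrib, add_zero] at h12
  rw [← h12]
  refine Finset.sum_congr rfl fun t _ => ?_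
  rcases Int.emod_two_eq_zero_or_one t.2.2 with he | he
  · simp [he]
  · rcases Int.emod_two_eq_zero_or_one t.2.1 with hd | hd
    · simp [he, hd, sixSquaresDefect_of_even_odd _ he hd]
    · simp [he, hd]

/-- The part of the boundary where the first and third arguments agree vanishes. -/
lemma sum_sixSquaresTest_diagonal (n : ℤ) :
    ∑ t ∈ (liouvilleTriples n).filter (fun t => 2 * t.1 + t.2.1 - t.2.2 = 0),
      sixSquaresTest (t.2.2 - 2 * t.1) (t.1 + t.2.1) (2 * t.1 + 2 * t.2.1 - t.2.2) = 0 := by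
  refine Finset.sum_eq_zero ?_
  rintro ⟨u, d, e⟩ h
  have h0 := (Finset.mem_filter.1 h).2
  dsimp only at h0 ⊢
  rw [show e - 2 * u = d by omega, show 2 * u + 2 * d - e = d by omega]
  unfold sixSquaresTest
  rw [chiInt_of_even (by omega)]
  simp

lemma sum_chiInt_range (l : ℕ) :
    (∑ m ∈ Finset.range (2 * l), chiInt m * (m : ℤ) = if l % 2 = 0 then -(l : ℤ) else l) ∧
    (∑ m ∈ Finset.range (2 * l), chiInt m * (m : ℤ) ^ 2 =
      if l % 2 = 0 then -2 * (l : ℤ) ^ 2 else 2 * (l : ℤ) ^ 2 - 1) ∧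
    (∑ m ∈ Finset.range (2 * l), chiInt m * (m : ℤ) ^ 3 =
      if l % 2 = 0 then 3 * (l : ℤ) - 4 * (l : ℤ) ^ 3 else 4 * (l : ℤ) ^ 3 - 3 * l) := by
  induction l with
  | zero => simp
  | succ l ih =>
    obtain ⟨h1, h2, h3⟩ := ih
    have he : chiInt ((2 * l : ℕ) : ℤ) = 0 := chiInt_of_even (by omega)
    simp only [show 2 * (l + 1) = 2 * l + 1 + 1 by ring, Finset.sum_range_succ, h1, h2, h3, he]
    rcases Nat.mod_two_eq_zero_or_one l with h | h
    · have ho : chiInt ((2 * l + 1 : ℕ) : ℤ) = 1 := by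
        unfold chiInt; rw [if_pos (by omega)]
      simp only [ho, h, show (l + 1) % 2 = 1 by omega]
      push_cast
      refine ⟨?_, ?_, ?_⟩ <;> simp <;> ring
    · have ho : chiInt ((2 * l + 1 : ℕ) : ℤ) = -1 := by
        unfold chiInt; rw [if_neg (by omega), if_pos (by omega)]
      simp only [ho, h, show (l + 1) % 2 = 0 by omega]
      push_cast
      refine ⟨?_, ?_, ?_⟩ <;> simp <;> ring

lemma sum_boundary_sq {n : ℤ} {l : ℕ} (hl : 0 < l) (hn : n = (l : ℤ) ^ 2) :
    ∑ t ∈ (liouvilleTriples n).filter (fun t => 2 * t.1 + t.2.2 - t.2.1 = 0),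
      sixSquaresTest (t.2.1 + t.2.2) t.1 (t.2.1 - t.2.2) = -3 * n := by
  have h : ∑ t ∈ (liouvilleTriples n).filter (fun t => 2 * t.1 + t.2.2 - t.2.1 = 0),
      sixSquaresTest (t.2.1 + t.2.2) t.1 (t.2.1 - t.2.2) =
      ∑ m ∈ Finset.range (2 * l), sixSquaresTest (2 * l) (m - l) (2 * (m - l)) := by
    have hsum (t : ℤ × ℤ × ℤ)
        (ht : t ∈ (liouvilleTriples n).filter (fun t => 2 * t.1 + t.2.2 - t.2.1 = 0)) :
        t.1 + t.2.2 = l := by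
      obtain ⟨u, d, e⟩ := t
      simp only [Finset.mem_filter, mem_liouvilleTriples] at ht ⊢
      have : (u + e) ^ 2 = (l : ℤ) ^ 2 := by
        rw [← hn, ← ht.1.2.2, show d = 2 * u + e by omega]
        ring
      exact (pow_left_inj₀ (by omega) (by omega) two_ne_zero).1 this
    rw [← Finset.sum_subset (s₁ := Finset.Ico 1 (2 * l))]
    · refine Finset.sum_nbij' (fun t => t.2.1.toNat)
        (fun m => ((m : ℤ) - l, (m : ℤ), 2 * (l : ℤ) - m)) ?_ ?_ ?_ ?_ ?_
      · intro t ht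
        have := hsum t ht
        simp only [Finset.mem_filter, mem_liouvilleTriples, Finset.mem_Ico] at ht ⊢
        omega
      · intro m hm
        simp only [Finset.mem_filter, mem_liouvilleTriples, Finset.mem_Ico] at hm ⊢
        refine ⟨⟨by omega, by omega, ?_⟩, by omega⟩
        rw [hn]
        ring
      · rintro ⟨u, d, e⟩ ht
        have := hsum _ ht
        simp only [Finset.mem_filter, mem_liouvilleTriples] at ht
        simp only [Prod.mk.injEq] at this ⊢
        omega
      · simp
      · rintro ⟨u, d, e⟩ ht
        have := hsum _ ht
        simp only [Finset.mem_filter, mem_liouvilleTriples] at ht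
        simp only at this ⊢
        congr 1 <;> omega
    · intro m hm
      simp only [Finset.mem_Ico, Finset.mem_range] at hm ⊢
      omega
    · intro m hm hm'
      simp only [Finset.mem_Ico, Finset.mem_range] at hm hm'
      obtain rfl : m = 0 := by omega
      rw [sixSquaresTest_two_mul, chiInt_of_even (by omega), zero_mul]
  obtain ⟨h1, h2, h3⟩ := sum_chiInt_range l
  rw [h, hn]
  simp only [sixSquaresTest_two_mul]
  rcases Nat.mod_two_eq_zero_or_one l with hp | hp
  · rw [if_pos hp] at h1 h2 h3
    have hp' : ¬ (l : ℤ) % 2 = 1 := by omega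
    simp only [hp', if_false]
    calc _ = ∑ m ∈ Finset.range (2 * l), ((l : ℤ) * (3 * l * (chiInt m * (m : ℤ) ^ 2)
          - chiInt m * (m : ℤ) ^ 3 - 2 * (l : ℤ) ^ 2 * (chiInt m * (m : ℤ)))) := by
          refine Finset.sum_congr rfl fun m _ => ?_
          rw [show (l : ℤ) + (m - l) = m by ring]
          ring
      _ = _ := by
          rw [← Finset.mul_sum, Finset.sum_sub_distrib, Finset.sum_sub_distrib, ← Finset.mul_sum,
            ← Finset.mul_sum, h1, h2, h3]
          ring
  · have hp0 : ¬ l % 2 = 0 := by omega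
    rw [if_neg hp0] at h1 h2 h3
    have hp' : (l : ℤ) % 2 = 1 := by omega
    simp only [hp', if_true]
    calc _ = ∑ m ∈ Finset.range (2 * l), (-3 * (l : ℤ) ^ 2 * (2 * l * (chiInt m * (m : ℤ))
          - chiInt m * (m : ℤ) ^ 2)) := by
          refine Finset.sum_congr rfl fun m _ => ?_
          rw [show (l : ℤ) + (m - l) = m by ring]
          ring
      _ = _ := by
          rw [← Finset.mul_sum, Finset.sum_sub_distrib, ← Finset.mul_sum, h1, h2]
          ring

lemma sum_boundary_of_not_sq {n : ℤ} (hn : ∀ l : ℤ, n ≠ l ^ 2) :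
    ∑ t ∈ (liouvilleTriples n).filter (fun t => 2 * t.1 + t.2.2 - t.2.1 = 0),
      sixSquaresTest (t.2.1 + t.2.2) t.1 (t.2.1 - t.2.2) = 0 := by
  refine Finset.sum_eq_zero ?_
  rintro ⟨u, d, e⟩ h
  simp only [Finset.mem_filter, mem_liouvilleTriples] at h
  refine absurd ?_ (hn (u + e))
  rw [← h.1.2.2, show d = 2 * u + e by omega]
  ring

/-- The divisor sum in the six squares formula. -/
noncomputable def sixSquaresDivisorSum (m : ℤ) : ℤ :=
  ∑ p ∈ factorPairs m, chiInt p.1 * (16 * p.2 ^ 2 - 4 * p.1 ^ 2)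

lemma sum_sixSquaresDivisorSum (n : ℤ) :
    ∑ u ∈ Finset.Icc (-n) n, (n - 7 * u ^ 2) * sixSquaresDivisorSum (n - u ^ 2) =
      -4 * ∑ t ∈ (liouvilleTriples n).filter (fun t => 2 * t.1 + t.2.2 - t.2.1 = 0),
        sixSquaresTest (t.2.1 + t.2.2) t.1 (t.2.1 - t.2.2) := by
  have h1 : ∑ u ∈ Finset.Icc (-n) n, (n - 7 * u ^ 2) * sixSquaresDivisorSum (n - u ^ 2) =
      4 * ∑ t ∈ liouvilleTriples n, (t.2.1 * t.2.2 - 6 * t.1 ^ 2) * (4 * t.2.2 ^ 2 - t.2.1 ^ 2)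
        * chiInt t.2.1 := by
    simp only [sixSquaresDivisorSum, Finset.mul_sum]
    rw [Finset.sum_finset_product (liouvilleTriples n) (Finset.Icc (-n) n)
      (fun u => factorPairs (n - u ^ 2))]
    · refine Finset.sum_congr rfl fun u _ => Finset.sum_congr rfl fun p hp => ?_
      have := (mem_factorPairs.1 hp).2.2
      rw [show n = p.1 * p.2 + u ^ 2 by omega]
      ring
    · rintro ⟨u, d, e⟩
      simp only [mem_liouvilleTriples, mem_factorPairs, Finset.mem_Icc]
      constructor
      · rintro ⟨hd, he, h⟩
        have := mul_pos hd he
        exact ⟨abs_le_of_sq_le (by omega), hd, he, by omega⟩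
      · rintro ⟨-, hd, he, h⟩
        exact ⟨hd, he, by omega⟩
  have h2 := sum_sixSquaresDefect n
  simp only [sixSquaresDefect, Finset.sum_add_distrib, Finset.sum_sub_distrib,
    ← Finset.mul_sum] at h2
  have h3 := liouville_identity sixSquaresTest_neg_left sixSquaresTest_neg_right n
  rw [sum_sixSquaresTest_diagonal] at h3
  rw [h1]
  linear_combination 4 * h2 + 4 * h3

/-- The divisor sum, completed by the value `1` at `0`. -/
noncomputable def sixSquaresSeries (m : ℤ) : ℤ :=
  sixSquaresDivisorSum m + if m = 0 then 1 else 0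

lemma sum_sixSquaresSeries {n : ℤ} (hn : 0 < n) :
    ∑ u ∈ Finset.Icc (-n) n, (n - 7 * u ^ 2) * sixSquaresSeries (n - u ^ 2) = 0 := by
  simp only [sixSquaresSeries, mul_add, Finset.sum_add_distrib, sum_sixSquaresDivisorSum]
  by_cases h : ∃ l : ℤ, n = l ^ 2
  · obtain ⟨l, hl⟩ := h
    have hl0 : l ≠ 0 := by
      rintro rfl
      simp at hl
      omega
    rw [sum_boundary_sq (l := l.natAbs) (by omega) (by rw [hl, Int.natCast_natAbs, sq_abs]),
      Finset.sum_eq_sum_sdiff_singleton_add (i := l),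
      Finset.sum_eq_sum_sdiff_singleton_add (i := -l),
      Finset.sum_eq_zero]
    · rw [neg_sq, ← hl]
      simp
      ring
    · intro u hu
      simp only [Finset.mem_sdiff, Finset.mem_singleton] at hu
      rw [if_neg, mul_zero]
      rw [hl, sub_eq_zero, eq_comm, sq_eq_sq_iff_eq_or_eq_neg]
      tauto
    · simp only [Finset.mem_sdiff, Finset.mem_singleton, Finset.mem_Icc]
      have := abs_le_of_sq_le hl.ge
      omega
    · simpa using abs_le_of_sq_le hl.ge
  · push Not at h
    rw [sum_boundary_of_not_sq h, Finset.sum_eq_zero, mul_zero, add_zero]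
    intro u _
    rw [if_neg, mul_zero]
    have := h u
    omega

/-- The representations of `n` as an ordered sum of `k` squares. -/
noncomputable def squareReps (k : ℕ) (n : ℤ) : Finset (Fin k → ℤ) :=
  (Fintype.piFinset fun _ => Finset.Icc (-n) n).filter fun v => ∑ i, v i ^ 2 = n

lemma mem_squareReps {k : ℕ} {n : ℤ} {v : Fin k → ℤ} :
    v ∈ squareReps k n ↔ ∑ i, v i ^ 2 = n := by
  simp only [squareReps, Finset.mem_filter, Fintype.mem_piFinset, Finset.mem_Icc,
    and_iff_right_iff_imp]
  intro h i
  refine abs_le_of_sq_le ?_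
  rw [← h]
  exact Finset.single_le_sum (f := fun i => v i ^ 2) (fun j _ => sq_nonneg (v j))
    (Finset.mem_univ i)

lemma sum_squareReps_apply (k : ℕ) (n : ℤ) (i j : Fin k) :
    ∑ v ∈ squareReps k n, v i ^ 2 = ∑ v ∈ squareReps k n, v j ^ 2 := by
  refine Finset.sum_nbij' (fun v => v ∘ Equiv.swap i j) (fun v => v ∘ Equiv.swap i j)
    ?_ ?_ ?_ ?_ ?_
  · intro v hv
    rw [mem_squareReps] at hv ⊢
    rw [← hv]
    exact Equiv.sum_comp (Equiv.swap i j) fun i => v i ^ 2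
  · intro v hv
    rw [mem_squareReps] at hv ⊢
    rw [← hv]
    exact Equiv.sum_comp (Equiv.swap i j) fun i => v i ^ 2
  · intro v _
    ext
    simp
  · intro v _
    ext
    simp
  · simp

lemma sum_squareReps_succ (k : ℕ) (n : ℤ) :
    ∑ v ∈ squareReps (k + 1) n, (n - (k + 1) * v 0 ^ 2) = 0 := by
  have h : ∑ i, ∑ v ∈ squareReps (k + 1) n, v i ^ 2 = ∑ v ∈ squareReps (k + 1) n, n := by
    rw [Finset.sum_comm]
    exact Finset.sum_congr rfl fun v hv => mem_squareReps.1 hv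
  rw [Finset.sum_congr rfl fun i _ => sum_squareReps_apply (k + 1) n i 0] at h
  rw [Finset.sum_sub_distrib, ← h, ← Finset.mul_sum]
  simp

lemma sum_card_squareReps (k : ℕ) (n : ℤ) :
    ∑ u ∈ Finset.Icc (-n) n, (n - (k + 1) * u ^ 2) * ((squareReps k (n - u ^ 2)).card : ℤ) = 0 := by
  rw [← sum_squareReps_succ k n]
  have h : ∀ u : ℤ, (n - (k + 1) * u ^ 2) * ((squareReps k (n - u ^ 2)).card : ℤ) =
      ∑ _w ∈ squareReps k (n - u ^ 2), (n - (k + 1) * u ^ 2) := by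
    intro u
    rw [Finset.sum_const, nsmul_eq_mul, mul_comm]
  simp only [h]
  rw [Finset.sum_sigma']
  refine Finset.sum_nbij' (fun p => (Fin.cons p.1 p.2 : Fin (k + 1) → ℤ))
    (fun v => ⟨v 0, Fin.tail v⟩) ?_ ?_ ?_ ?_ ?_
  · rintro ⟨u, w⟩ hp
    simp only [Finset.mem_sigma, mem_squareReps] at hp
    rw [mem_squareReps, Fin.sum_univ_succ]
    simp only [Fin.cons_zero, Fin.cons_succ, hp.2]
    ring
  · intro v hv
    rw [mem_squareReps, Fin.sum_univ_succ] at hv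
    have h0 : 0 ≤ ∑ i : Fin k, v i.succ ^ 2 := Finset.sum_nonneg fun i _ => sq_nonneg _
    simp only [Finset.mem_sigma, mem_squareReps, Finset.mem_Icc, Fin.tail]
    exact ⟨abs_le_of_sq_le (by omega), by omega⟩
  · rintro ⟨u, w⟩ _
    simp
  · intro v _
    simp
  · simp

lemma card_squareReps_six_of_neg {n : ℤ} (hn : n < 0) :
    ((squareReps 6 n).card : ℤ) = sixSquaresSeries n := by
  rw [sixSquaresSeries, sixSquaresDivisorSum, Finset.sum_eq_zero, if_neg hn.ne]
  · rw [Finset.eq_empty_of_forall_notMem (s := squareReps 6 n)]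
    · simp
    · intro v hv
      rw [mem_squareReps] at hv
      have h0 : 0 ≤ ∑ i, v i ^ 2 := Finset.sum_nonneg fun i _ => sq_nonneg _
      omega
  · intro p hp
    obtain ⟨h1, h2, h3⟩ := mem_factorPairs.1 hp
    have := mul_pos h1 h2
    omega

lemma card_squareReps_six_zero : ((squareReps 6 0).card : ℤ) = sixSquaresSeries 0 := by
  have h : squareReps 6 0 = {0} := by
    ext v
    rw [mem_squareReps, Finset.sum_eq_zero_iff_of_nonneg fun i _ => sq_nonneg _]
    simp [funext_iff]
  rw [h]
  simp [sixSquaresSeries, sixSquaresDivisorSum, factorPairs]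

lemma card_squareReps_six (n : ℤ) : ((squareReps 6 n).card : ℤ) = sixSquaresSeries n := by
  rcases lt_trichotomy n 0 with hn | rfl | hn
  · exact card_squareReps_six_of_neg hn
  · exact card_squareReps_six_zero
  · induction hN : n.toNat using Nat.strong_induction_on generalizing n with
    | _ N ih =>
      have h0 : (0 : ℤ) ∈ Finset.Icc (-n) n := by simp [hn.le]
      have hR := sum_card_squareReps 6 n
      have hG := sum_sixSquaresSeries hn
      rw [Finset.sum_eq_sum_sdiff_singleton_add h0] at hR hG
      have hEq : ∀ u ∈ Finset.Icc (-n) n \ {0},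
          (n - ((6 : ℕ) + 1) * u ^ 2) * ((squareReps 6 (n - u ^ 2)).card : ℤ) =
          (n - 7 * u ^ 2) * sixSquaresSeries (n - u ^ 2) := by
        intro u hu
        have hu0 : u ≠ 0 := by simpa using (Finset.mem_sdiff.1 hu).2
        have hu2 : 0 < u ^ 2 := by positivity
        rcases lt_trichotomy (n - u ^ 2) 0 with h | h | h
        · rw [card_squareReps_six_of_neg h]
          norm_num
        · rw [h, card_squareReps_six_zero]
          norm_num
        · rw [ih (n - u ^ 2).toNat (by omega) _ h rfl]
          norm_num
      rw [Finset.sum_congr rfl hEq] at hR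
      have h := hR.trans hG.symm
      simp only [add_right_inj, zero_pow two_ne_zero, mul_zero, sub_zero] at h
      exact mul_left_cancel₀ hn.ne' h

lemma natCast_div_toNat_of_mem_factorPairs {n : ℕ} {p : ℤ × ℤ} (hp : p ∈ factorPairs n) :
    ((n / p.1.toNat : ℕ) : ℤ) = p.2 := by
  obtain ⟨h1, h2, h3⟩ := mem_factorPairs.1 hp
  rw [Int.natCast_div, Int.toNat_of_nonneg h1.le, ← h3, Int.mul_ediv_cancel_left _ h1.ne']

theorem stmt0 (n : ℕ) (hn : 0 < n) :
    (r6 n : ℤ) =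
      16 * ∑ d ∈ n.divisors, chi4 d * ((n / d : ℕ) : ℤ) ^ 2
        - 4 * ∑ d ∈ n.divisors, chi4 d * (d : ℤ) ^ 2 := by
  have h1 : r6 n = (squareReps 6 n).card := Nat.subtype_card _ fun v => mem_squareReps
  rw [h1, card_squareReps_six, sixSquaresSeries, if_neg (by omega), add_zero,
    sixSquaresDivisorSum, Finset.mul_sum, Finset.mul_sum, ← Finset.sum_sub_distrib]
  refine Finset.sum_nbij' (fun p => p.1.toNat) (fun d => ((d : ℤ), ((n / d : ℕ) : ℤ)))
    ?_ ?_ ?_ ?_ ?_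
  · intro p hp
    obtain ⟨h1, h2, h3⟩ := mem_factorPairs.1 hp
    rw [Nat.mem_divisors]
    refine ⟨?_, hn.ne'⟩
    zify
    rw [Int.toNat_of_nonneg h1.le, ← h3]
    exact dvd_mul_right _ _
  · intro d hd
    have hd' := Nat.dvd_of_mem_divisors hd
    rw [mem_factorPairs]
    dsimp only
    refine ⟨?_, ?_, ?_⟩
    · exact_mod_cast Nat.pos_of_mem_divisors hd
    · exact_mod_cast Nat.div_pos (Nat.le_of_dvd hn hd') (Nat.pos_of_mem_divisors hd)
    · exact_mod_cast Nat.mul_div_cancel' hd'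
  · rintro ⟨d, e⟩ hp
    rw [natCast_div_toNat_of_mem_factorPairs hp,
      Int.toNat_of_nonneg (mem_factorPairs.1 hp).1.le]
  · simp
  · rintro ⟨d, e⟩ hp
    rw [natCast_div_toNat_of_mem_factorPairs hp, ← chiInt_natCast]
    dsimp only
    rw [Int.toNat_of_nonneg (mem_factorPairs.1 hp).1.le]
    ring
end

section
/- For every complex number s with Re(s) > 3, the Dirichlet series of r_6 satisfies ∑_{n=1}^∞ r_6(n)/n^s = 16·ζ(s−2)·L(s,χ) − 4·ζ(s)·L(s−2,χ), where ζ is the Riemann zeta function and L(·,χ) is the Dirichlet L-function of the nonprincipal character χ modulo 4. -/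
namespace SixSquares

open Finset

/-- The triples `(i, d, δ)` with `i² + dδ = n` and `d, δ > 0`. -/
noncomputable def triples (n : ℤ) : Finset (ℤ × ℤ × ℤ) :=
  (Icc (-n) n ×ˢ Icc 1 n ×ˢ Icc 1 n).filter fun t => t.1 ^ 2 + t.2.1 * t.2.2 = n

lemma mem_triples {n : ℤ} {t : ℤ × ℤ × ℤ} :
    t ∈ triples n ↔ t.1 ^ 2 + t.2.1 * t.2.2 = n ∧ 0 < t.2.1 ∧ 0 < t.2.2 := by
  obtain ⟨i, d, e⟩ := t
  simp only [triples, mem_filter, mem_product, mem_Icc]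
  constructor
  · rintro ⟨⟨-, ⟨h1, -⟩, h2, -⟩, h⟩
    exact ⟨h, by lia, by lia⟩
  · rintro ⟨h, hd, he⟩
    have h1 : 1 ≤ d := hd
    have h2 : 1 ≤ e := he
    refine ⟨⟨⟨?_, ?_⟩, ⟨h1, ?_⟩, h2, ?_⟩, h⟩ <;> nlinarith [mul_pos hd he]

section Liouville

variable {F : ℤ → ℤ → ℤ → ℤ}

/-- The involution `(i, d, δ) ↦ (δ - i, d + 2i - δ, δ)` cancels the part `δ < d + 2i`. -/
lemma sum_triples_lt (n : ℤ) (hx : ∀ x y z, F (-x) y z = -F x y z) :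
    ∑ t ∈ (triples n).filter (fun t => t.2.2 < t.2.1 + 2 * t.1),
      F (t.2.2 - 2 * t.1) (t.2.1 + t.1) (2 * t.2.1 + 2 * t.1 - t.2.2) = 0 := by
  refine sum_involution (fun t _ => (t.2.2 - t.1, t.2.1 + 2 * t.1 - t.2.2, t.2.2)) ?_ ?_ ?_ ?_
  · rintro ⟨i, d, e⟩ -
    have := hx (e - 2 * i) (d + i) (2 * d + 2 * i - e)
    dsimp only
    rw [show e - 2 * (e - i) = -(e - 2 * i) by ring, show d + 2 * i - e + (e - i) = d + i by ring,
      show 2 * (d + 2 * i - e) + 2 * (e - i) - e = 2 * d + 2 * i - e by ring, this]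
    ring
  · rintro ⟨i, d, e⟩ - hF h
    apply hF
    simp only [Prod.mk.injEq] at h
    have h0 := hx 0 (d + i) (2 * d + 2 * i - e)
    dsimp only
    rw [show e - 2 * i = 0 by lia]
    rw [neg_zero] at h0
    lia
  · rintro ⟨i, d, e⟩ h
    simp only [mem_filter, mem_triples] at h ⊢
    obtain ⟨⟨h, hd, he⟩, hlt⟩ := h
    exact ⟨⟨by linear_combination h, by lia, he⟩, by lia⟩
  · rintro ⟨i, d, e⟩ -
    simp only [Prod.mk.injEq, and_true]
    constructor <;> ring

lemma sum_triples_gt (n : ℤ) :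
    ∑ t ∈ (triples n).filter (fun t => t.2.1 + 2 * t.1 < t.2.2),
      F (t.2.2 - 2 * t.1) (t.2.1 + t.1) (2 * t.2.1 + 2 * t.1 - t.2.2) =
    ∑ t ∈ (triples n).filter (fun t => t.2.1 - t.2.2 < 2 * t.1),
      F (t.2.1 + t.2.2) t.1 (t.2.1 - t.2.2) := by
  refine sum_nbij' (fun t => (t.2.1 + t.1, t.2.1, t.2.2 - 2 * t.1 - t.2.1))
    (fun t => (t.1 - t.2.1, t.2.1, t.2.2 + 2 * t.1 - t.2.1)) ?_ ?_ ?_ ?_ ?_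
  · rintro ⟨i, d, e⟩ h
    simp only [mem_filter, mem_triples] at h ⊢
    obtain ⟨⟨h, hd, he⟩, hlt⟩ := h
    exact ⟨⟨by linear_combination h, by lia, by lia⟩, by lia⟩
  · rintro ⟨i, d, e⟩ h
    simp only [mem_filter, mem_triples] at h ⊢
    obtain ⟨⟨h, hd, he⟩, hlt⟩ := h
    exact ⟨⟨by linear_combination h, by lia, by lia⟩, by lia⟩
  · rintro ⟨i, d, e⟩ -
    simp only [Prod.mk.injEq]
    refine ⟨?_, trivial, ?_⟩ <;> ring
  · rintro ⟨i, d, e⟩ -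
    simp only [Prod.mk.injEq]
    refine ⟨?_, trivial, ?_⟩ <;> ring
  · rintro ⟨i, d, e⟩ -
    dsimp only
    congr 1 <;> ring

lemma sum_triples_half (n : ℤ) (hy : ∀ x y z, F x (-y) z = -F x y z)
    (hyz : ∀ x y z, F x (-y) (-z) = F x y z) (hz : ∀ x y, F x y (2 * y) = 0) :
    ∑ t ∈ (triples n).filter (fun t => t.2.1 - t.2.2 < 2 * t.1),
      F (t.2.1 + t.2.2) t.1 (t.2.1 - t.2.2) = 0 := by
  have hall : ∑ t ∈ triples n, F (t.2.1 + t.2.2) t.1 (t.2.1 - t.2.2) = 0 := by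
    have h : ∑ t ∈ triples n, F (t.2.1 + t.2.2) t.1 (t.2.1 - t.2.2) =
        ∑ t ∈ triples n, -F (t.2.1 + t.2.2) t.1 (t.2.1 - t.2.2) := by
      refine sum_nbij' (fun t => (-t.1, t.2)) (fun t => (-t.1, t.2)) ?_ ?_ ?_ ?_ ?_
      · rintro ⟨i, d, e⟩ h
        simpa [mem_triples] using h
      · rintro ⟨i, d, e⟩ h
        simpa [mem_triples] using h
      · simp
      · simp
      · simp [hy]
    rw [sum_neg_distrib] at h
    lia
  have hswap : ∑ t ∈ (triples n).filter (fun t => t.2.1 - t.2.2 < 2 * t.1),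
      F (t.2.1 + t.2.2) t.1 (t.2.1 - t.2.2) =
      ∑ t ∈ (triples n).filter (fun t => ¬ t.2.1 - t.2.2 < 2 * t.1),
      F (t.2.1 + t.2.2) t.1 (t.2.1 - t.2.2) := by
    have hne : ∑ t ∈ (triples n).filter (fun t => ¬ t.2.1 - t.2.2 < 2 * t.1),
        F (t.2.1 + t.2.2) t.1 (t.2.1 - t.2.2) =
        ∑ t ∈ (triples n).filter (fun t => 2 * t.1 < t.2.1 - t.2.2),
        F (t.2.1 + t.2.2) t.1 (t.2.1 - t.2.2) := by
      symm
      refine sum_subset ?_ ?_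
      · intro t
        simp only [mem_filter]
        exact fun h => ⟨h.1, by lia⟩
      · rintro ⟨i, d, e⟩ h1 h2
        simp only [mem_filter] at h1 h2
        have h3 : d - e = 2 * i := by
          by_contra h3
          exact h2 ⟨h1.1, by lia⟩
        dsimp only
        rw [h3, hz]
    rw [hne]
    refine sum_nbij' (fun t => (-t.1, t.2.2, t.2.1)) (fun t => (-t.1, t.2.2, t.2.1)) ?_ ?_ ?_ ?_ ?_
    · rintro ⟨i, d, e⟩ h
      simp only [mem_filter, mem_triples] at h ⊢
      exact ⟨⟨by linear_combination h.1.1, h.1.2.2, h.1.2.1⟩, by lia⟩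
    · rintro ⟨i, d, e⟩ h
      simp only [mem_filter, mem_triples] at h ⊢
      exact ⟨⟨by linear_combination h.1.1, h.1.2.2, h.1.2.1⟩, by lia⟩
    · simp
    · simp
    · rintro ⟨i, d, e⟩ -
      dsimp only
      rw [← hyz, neg_sub, add_comm]
  have := sum_filter_add_sum_filter_not (triples n) (fun t => t.2.1 - t.2.2 < 2 * t.1)
    (fun t => F (t.2.1 + t.2.2) t.1 (t.2.1 - t.2.2))
  lia

lemma sum_triples_eq (n : ℤ) :
    ∑ t ∈ (triples n).filter (fun t => t.2.2 = t.2.1 + 2 * t.1),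
      F (t.2.2 - 2 * t.1) (t.2.1 + t.1) (2 * t.2.1 + 2 * t.1 - t.2.2) =
    ∑ s ∈ (Icc 1 n).filter (fun s => s ^ 2 = n), ∑ d ∈ Ioo 0 (2 * s), F d s d := by
  rw [sum_sigma']
  refine sum_nbij' (fun t => ⟨t.2.1 + t.1, t.2.1⟩)
    (fun p => (p.1 - p.2, p.2, 2 * p.1 - p.2)) ?_ ?_ ?_ ?_ ?_
  · rintro ⟨i, d, e⟩ h
    simp only [mem_filter, mem_triples, mem_sigma, mem_Icc, mem_Ioo] at h ⊢
    obtain ⟨⟨h, hd, he⟩, heq⟩ := h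
    have hs : (d + i) ^ 2 = n := by subst heq; linear_combination h
    exact ⟨⟨⟨by lia, by nlinarith⟩, hs⟩, hd, by lia⟩
  · rintro ⟨s, d⟩ h
    simp only [mem_filter, mem_triples, mem_sigma, mem_Icc, mem_Ioo] at h ⊢
    obtain ⟨⟨-, h⟩, hd, he⟩ := h
    exact ⟨⟨by linear_combination h, hd, by lia⟩, by ring⟩
  · rintro ⟨i, d, e⟩ h
    simp only [mem_filter] at h
    simp only [Prod.mk.injEq]
    refine ⟨by ring, trivial, by lia⟩
  · rintro ⟨s, d⟩ -
    simp
  · rintro ⟨i, d, e⟩ h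
    simp only [mem_filter] at h
    dsimp only
    rw [h.2]
    congr 1 <;> ring

/-- A Liouville-type identity for the representations `n = i² + dδ`. -/
theorem sum_triples (n : ℤ) (hx : ∀ x y z, F (-x) y z = -F x y z)
    (hy : ∀ x y z, F x (-y) z = -F x y z)
    (hyz : ∀ x y z, F x (-y) (-z) = F x y z) (hz : ∀ x y, F x y (2 * y) = 0) :
    ∑ t ∈ triples n, F (t.2.2 - 2 * t.1) (t.2.1 + t.1) (2 * t.2.1 + 2 * t.1 - t.2.2) =
    ∑ s ∈ (Icc 1 n).filter (fun s => s ^ 2 = n), ∑ d ∈ Ioo 0 (2 * s), F d s d := by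
  rw [← sum_filter_add_sum_filter_not (triples n) (fun t => t.2.2 < t.2.1 + 2 * t.1),
    sum_triples_lt n hx, zero_add,
    ← sum_filter_add_sum_filter_not _ (fun t : ℤ × ℤ × ℤ => t.2.2 = t.2.1 + 2 * t.1),
    filter_filter, filter_filter, ← sum_triples_eq, add_eq_left.2]
  · congr 1
    ext t
    simp only [mem_filter]
    exact and_congr_right fun _ => by lia
  · rw [← sum_triples_half n hy hyz hz, ← sum_triples_gt]
    congr 1
    ext t
    simp only [mem_filter]
    exact and_congr_right fun _ => by lia

end Liouville

open ZMod (χ₄)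

lemma sum_range_chi4_mul (s : ℕ) :
    ∑ d ∈ range (2 * s), χ₄ (d : ZMod 4) * (d : ℤ) = -(-1) ^ s * s := by
  induction s with
  | zero => simp
  | succ s ih =>
    rw [show 2 * (s + 1) = 2 * s + 1 + 1 by ring, sum_range_succ, sum_range_succ, ih,
      ZMod.χ₄_eq_neg_one_pow (n := 2 * s + 1) (by lia), show (2 * s + 1) / 2 = s by lia,
      ZMod.χ₄_nat_eq_if_mod_four (2 * s), if_pos (by lia)]
    push_cast
    ring

lemma sum_range_chi4_mul_cube (s : ℕ) :
    ∑ d ∈ range (2 * s), χ₄ (d : ZMod 4) * (d : ℤ) ^ 3 = -(-1) ^ s * (4 * s ^ 3 - 3 * s) := by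
  induction s with
  | zero => simp
  | succ s ih =>
    rw [show 2 * (s + 1) = 2 * s + 1 + 1 by ring, sum_range_succ, sum_range_succ, ih,
      ZMod.χ₄_eq_neg_one_pow (n := 2 * s + 1) (by lia), show (2 * s + 1) / 2 = s by lia,
      ZMod.χ₄_nat_eq_if_mod_four (2 * s), if_pos (by lia)]
    push_cast
    ring

lemma chi4_two_mul_sub (s d : ℕ) :
    χ₄ (2 * (s : ZMod 4) - d) = -(-1) ^ s * χ₄ (d : ZMod 4) := by
  have h0 : ∀ d : ZMod 4, χ₄ (-d) = -χ₄ d := by decide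
  have h1 : ∀ d : ZMod 4, χ₄ (2 - d) = χ₄ d := by decide
  have h4 : (4 : ZMod 4) = 0 := rfl
  rcases Nat.even_or_odd' s with ⟨k, rfl | rfl⟩
  · have : 2 * ((2 * k : ℕ) : ZMod 4) - d = -d := by
      push_cast; linear_combination (k : ZMod 4) * h4
    rw [this, h0, pow_mul]; simp
  · have : 2 * ((2 * k + 1 : ℕ) : ZMod 4) - d = 2 - d := by
      push_cast; linear_combination (k : ZMod 4) * h4
    rw [this, h1, pow_succ, pow_mul]; simp

lemma sum_Ioo_chi4 {s : ℤ} (hs : 0 < s) :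
    ∑ d ∈ Ioo 0 (2 * s), χ₄ ((2 * s - d : ℤ) : ZMod 4) * (d * s * (4 * s ^ 2 - d ^ 2)) =
      3 * s ^ 2 := by
  lift s to ℕ using hs.le
  have h : ∑ d ∈ Ioo 0 (2 * (s : ℤ)),
      χ₄ ((2 * s - d : ℤ) : ZMod 4) * (d * s * (4 * (s : ℤ) ^ 2 - d ^ 2)) =
      ∑ d ∈ range (2 * s), χ₄ ((2 * s - d : ℤ) : ZMod 4) *
        (d * s * (4 * (s : ℤ) ^ 2 - (d : ℤ) ^ 2)) := by
    symm
    refine (sum_of_injOn Int.toNat ?_ ?_ ?_ ?_).symm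
    · intro a ha b hb h
      simp only [coe_Ioo, Set.mem_Ioo] at ha hb
      lia
    · intro a ha
      simp only [coe_Ioo, Set.mem_Ioo, coe_range, Set.mem_Iio] at ha ⊢
      lia
    · intro d hd hd'
      have : d = 0 := by
        by_contra h0
        refine hd' ⟨d, ?_, by simp⟩
        simp only [mem_range, coe_Ioo, Set.mem_Ioo] at hd ⊢
        lia
      simp [this]
    · intro d hd
      rw [Int.toNat_of_nonneg (mem_Ioo.1 hd).1.le]
  rw [h]
  have h2 : ∀ d ∈ range (2 * s), χ₄ ((2 * s - d : ℤ) : ZMod 4) *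
        (d * s * (4 * (s : ℤ) ^ 2 - (d : ℤ) ^ 2)) =
      -(-1) ^ s * s * (4 * s ^ 2 * (χ₄ (d : ZMod 4) * (d : ℤ)) - χ₄ (d : ZMod 4) * (d : ℤ) ^ 3) := by
    intro d _
    push_cast
    rw [chi4_two_mul_sub]
    ring
  rw [sum_congr rfl h2, ← mul_sum, sum_sub_distrib, ← mul_sum, sum_range_chi4_mul,
    sum_range_chi4_mul_cube]
  have : ((-1 : ℤ) ^ s) ^ 2 = 1 := by rw [← pow_mul, mul_comm, pow_mul]; simp
  linear_combination 3 * (s : ℤ) ^ 2 * this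

theorem sum_triples_chi4 (n : ℤ) :
    ∑ t ∈ triples n, χ₄ (t.2.2 : ZMod 4) * ((t.2.2 - 2 * t.1) * (t.2.1 + t.1) *
      (4 * (t.2.1 + t.1) ^ 2 - (t.2.2 - 2 * t.1) ^ 2)) =
    ∑ s ∈ (Icc 1 n).filter (fun s => s ^ 2 = n), 3 * s ^ 2 := by
  have h := sum_triples n
    (F := fun x y z => χ₄ ((2 * y - z : ℤ) : ZMod 4) * (x * y * (4 * y ^ 2 - x ^ 2)))
    (fun x y z => by ring)
    (fun x y z => by
      have : ∀ y z : ZMod 4, χ₄ (2 * (-y) - z) = χ₄ (2 * y - z) := by decide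
      push_cast
      rw [this]
      ring)
    (fun x y z => by
      have : ∀ y z : ZMod 4, χ₄ (2 * (-y) - -z) = -χ₄ (2 * y - z) := by decide
      push_cast
      rw [this]
      ring)
    (fun x y => by simp)
  rw [sum_congr rfl fun s hs => (sum_Ioo_chi4 (mem_Icc.1 (mem_filter.1 hs).1).1).symm, ← h]
  refine sum_congr rfl fun t _ => ?_
  rw [show 2 * (t.2.1 + t.1) - (2 * t.2.1 + 2 * t.1 - t.2.2) = t.2.2 by ring]

/-- Symmetrising `sum_triples_chi4` in `i ↦ -i`. -/
theorem sum_triples_weight (n : ℤ) :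
    ∑ t ∈ triples n, (n - 7 * t.1 ^ 2) * (χ₄ (t.2.2 : ZMod 4) * (4 * t.2.1 ^ 2 - t.2.2 ^ 2)) =
    ∑ s ∈ (Icc 1 n).filter (fun s => s ^ 2 = n), 3 * s ^ 2 := by
  have h := sum_triples_chi4 n
  have hneg : ∑ t ∈ triples n, χ₄ (t.2.2 : ZMod 4) * ((t.2.2 - 2 * t.1) * (t.2.1 + t.1) *
      (4 * (t.2.1 + t.1) ^ 2 - (t.2.2 - 2 * t.1) ^ 2)) =
      ∑ t ∈ triples n, χ₄ (t.2.2 : ZMod 4) * ((t.2.2 - 2 * -t.1) * (t.2.1 + -t.1) *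
      (4 * (t.2.1 + -t.1) ^ 2 - (t.2.2 - 2 * -t.1) ^ 2)) := by
    refine sum_nbij' (fun t => (-t.1, t.2)) (fun t => (-t.1, t.2)) ?_ ?_ ?_ ?_ ?_
    · intro t ht
      simpa [mem_triples] using ht
    · intro t ht
      simpa [mem_triples] using ht
    · simp
    · simp
    · simp
  have hadd := congrArg₂ (· + ·) h (hneg.symm.trans h)
  simp only [← sum_add_distrib] at hadd
  have hw : ∑ t ∈ triples n,
      2 * ((n - 7 * t.1 ^ 2) * (χ₄ (t.2.2 : ZMod 4) * (4 * t.2.1 ^ 2 - t.2.2 ^ 2))) =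
      ∑ s ∈ (Icc 1 n).filter (fun s => s ^ 2 = n), (3 * s ^ 2 + 3 * s ^ 2) := by
    rw [← hadd]
    refine sum_congr rfl fun t ht => ?_
    rw [← (mem_triples.1 ht).1]
    ring
  rw [← mul_sum, sum_add_distrib] at hw
  lia


/-- The contribution of the factorisations `dδ = m` to the number of representations of `m`. -/
noncomputable def divisorPart (m : ℤ) : ℤ :=
  ∑ p ∈ (Icc 1 m ×ˢ Icc 1 m).filter fun p => p.1 * p.2 = m,
    χ₄ (p.2 : ZMod 4) * (4 * p.1 ^ 2 - p.2 ^ 2)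

lemma divisorPart_eq {m N : ℤ} (h : m ≤ N) :
    divisorPart m = ∑ p ∈ (Icc 1 N ×ˢ Icc 1 N).filter fun p => p.1 * p.2 = m,
      χ₄ (p.2 : ZMod 4) * (4 * p.1 ^ 2 - p.2 ^ 2) := by
  unfold divisorPart
  congr 1
  ext ⟨a, b⟩
  simp only [mem_filter, mem_product, mem_Icc]
  constructor
  · rintro ⟨⟨⟨h1, h2⟩, h3, h4⟩, h5⟩
    exact ⟨⟨⟨h1, by lia⟩, h3, by lia⟩, h5⟩
  · rintro ⟨⟨⟨h1, h2⟩, h3, h4⟩, h5⟩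
    exact ⟨⟨⟨h1, by nlinarith⟩, h3, by nlinarith⟩, h5⟩

lemma divisorPart_of_nonpos {m : ℤ} (h : m ≤ 0) : divisorPart m = 0 := by
  simp [divisorPart, Icc_eq_empty (show ¬ (1 : ℤ) ≤ m by lia)]

lemma sum_divisorPart (n : ℤ) :
    ∑ j ∈ Icc (-n) n, (n - 7 * j ^ 2) * divisorPart (n - j ^ 2) =
      ∑ s ∈ (Icc 1 n).filter (fun s => s ^ 2 = n), 3 * s ^ 2 := by
  rw [← sum_triples_weight, triples, sum_filter, sum_product]
  refine sum_congr rfl fun j _ => ?_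
  rw [divisorPart_eq (N := n) (by nlinarith), mul_sum, sum_filter]
  refine sum_congr rfl fun p _ => ?_
  simp only [eq_sub_iff_add_eq']

/-- The divisor-sum expression for the number of representations by six squares. -/
noncomputable def divisorSum (m : ℤ) : ℤ := (if m = 0 then 1 else 0) + 4 * divisorPart m

lemma sum_divisorSum {n : ℤ} (hn : 0 < n) :
    ∑ j ∈ Icc (-n) n, (n - 7 * j ^ 2) * divisorSum (n - j ^ 2) = 0 := by
  have hsq : ∑ j ∈ Icc (-n) n, (n - 7 * j ^ 2) * (if n - j ^ 2 = 0 then 1 else 0) =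
      ∑ s ∈ (Icc 1 n).filter (fun s => s ^ 2 = n), -12 * s ^ 2 := by
    have hI : Icc (-n) n = Icc 1 n ∪ ((Icc 1 n).image (fun s => -s) ∪ {0}) := by
      ext j
      simp only [mem_Icc, mem_union, mem_image, mem_singleton]
      constructor
      · intro h
        rcases lt_trichotomy j 0 with h0 | h0 | h0
        · exact Or.inr (Or.inl ⟨-j, by lia, by lia⟩)
        · exact Or.inr (Or.inr h0)
        · exact Or.inl (by lia)
      · rintro (h | ⟨a, h, rfl⟩ | rfl) <;> lia
    rw [hI, sum_union, sum_union, sum_image (by simp), sum_singleton, ← add_assoc,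
      ← sum_add_distrib, sum_filter]
    · rw [if_neg (by lia), mul_zero, add_zero]
      refine sum_congr rfl fun s _ => ?_
      rw [neg_sq]
      by_cases h : s ^ 2 = n
      · simp only [h, sub_self, if_true]
        ring
      · rw [if_neg (by lia), if_neg h]
        ring
    · rw [disjoint_left]
      simp only [mem_image, mem_Icc, mem_singleton]
      lia
    · rw [disjoint_left]
      simp only [mem_image, mem_Icc, mem_singleton, mem_union]
      rintro a h1 (⟨b, h2, rfl⟩ | rfl) <;> lia
  have h := sum_divisorPart n
  simp only [divisorSum, mul_add, sum_add_distrib]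
  rw [hsq]
  simp only [mul_left_comm _ (4 : ℤ), ← mul_sum]
  rw [h, ← mul_sum]
  ring

/-- The integral vectors of length `k` whose squares sum to `n`. -/
noncomputable def sphere (k : ℕ) (n : ℤ) : Finset (Fin k → ℤ) :=
  (Fintype.piFinset fun _ => Icc (-n) n).filter fun v => ∑ i, v i ^ 2 = n

lemma mem_sphere {k : ℕ} {n : ℤ} {v : Fin k → ℤ} : v ∈ sphere k n ↔ ∑ i, v i ^ 2 = n := by
  simp only [sphere, mem_filter, Fintype.mem_piFinset, mem_Icc, and_iff_right_iff_imp]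
  rintro rfl i
  have h : v i ^ 2 ≤ ∑ i, v i ^ 2 :=
    single_le_sum (f := fun i => v i ^ 2) (fun i _ => sq_nonneg _) (mem_univ i)
  exact abs_le.1 (((Int.le_self_sq |v i|).trans_eq (sq_abs _)).trans h)

lemma sphere_of_neg {k : ℕ} {n : ℤ} (hn : n < 0) : sphere k n = ∅ := by
  refine eq_empty_of_forall_notMem fun v hv => ?_
  rw [mem_sphere] at hv
  have : 0 ≤ ∑ i, v i ^ 2 := sum_nonneg fun i _ => sq_nonneg _
  lia

lemma card_sphere_zero (k : ℕ) : #(sphere k 0) = 1 := by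
  rw [card_eq_one]
  refine ⟨0, ?_⟩
  ext v
  rw [mem_sphere, mem_singleton, sum_eq_zero_iff_of_nonneg fun i _ => sq_nonneg _]
  simp [funext_iff]

lemma sum_sphere_head (k : ℕ) (n : ℤ) (g : ℤ → ℤ) :
    ∑ v ∈ sphere (k + 1) n, g (v 0) = ∑ j ∈ Icc (-n) n, g j * #(sphere k (n - j ^ 2)) := by
  rw [← sum_fiberwise_of_maps_to' (g := fun v : Fin (k + 1) → ℤ => v 0) (t := Icc (-n) n)]
  · refine sum_congr rfl fun j _ => ?_
    rw [sum_const, nsmul_eq_mul, mul_comm]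
    congr 2
    refine card_nbij' (fun v => Fin.tail v) (fun w => Fin.cons j w) ?_ ?_ ?_ ?_
    · intro v hv
      simp only [coe_filter, mem_sphere, Set.mem_ofPred_eq, Fin.sum_univ_succ, mem_coe] at hv ⊢
      rw [← hv.1, hv.2]
      simp [Fin.tail]
    · intro w hw
      simp only [coe_filter, mem_sphere, Set.mem_ofPred_eq, Fin.sum_univ_succ, mem_coe] at hw ⊢
      simp [hw]
    · intro v hv
      simp only [coe_filter, Set.mem_ofPred_eq] at hv
      simp [← hv.2]
    · intro w _
      simp
  · intro v hv
    simp only [sphere, mem_filter, Fintype.mem_piFinset] at hv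
    exact hv.1 0

lemma sum_sphere_coord (k : ℕ) (n : ℤ) (i : Fin (k + 1)) :
    ∑ v ∈ sphere (k + 1) n, v i ^ 2 = ∑ v ∈ sphere (k + 1) n, v 0 ^ 2 := by
  refine sum_nbij' (fun v => v ∘ Equiv.swap 0 i) (fun v => v ∘ Equiv.swap 0 i) ?_ ?_ ?_ ?_ ?_
  · intro v hv
    rw [mem_sphere] at hv ⊢
    rw [← hv]
    exact Equiv.sum_comp (Equiv.swap 0 i) fun j => v j ^ 2
  · intro v hv
    rw [mem_sphere] at hv ⊢
    rw [← hv]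
    exact Equiv.sum_comp (Equiv.swap 0 i) fun j => v j ^ 2
  · intro v _
    ext j
    simp
  · intro v _
    ext j
    simp
  · simp

/-- The recurrence for representation numbers coming from averaging over coordinates. -/
lemma sum_card_sphere (k : ℕ) (n : ℤ) :
    ∑ j ∈ Icc (-n) n, (n - (k + 1) * j ^ 2) * #(sphere k (n - j ^ 2)) = 0 := by
  rw [← sum_sphere_head k n fun j => n - (k + 1) * j ^ 2, sum_sub_distrib, ← mul_sum]
  have h : ∑ v ∈ sphere (k + 1) n, n = ∑ v ∈ sphere (k + 1) n, ∑ i, v i ^ 2 :=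
    sum_congr rfl fun v hv => (mem_sphere.1 hv).symm
  rw [h, sum_comm, sum_congr rfl fun i _ => sum_sphere_coord k n i]
  simp

lemma eq_of_recurrence (c : ℤ) {f g : ℤ → ℤ} (hf : ∀ m < 0, f m = 0) (hg : ∀ m < 0, g m = 0)
    (h0 : f 0 = g 0)
    (hf' : ∀ n > 0, ∑ j ∈ Icc (-n) n, (n - c * j ^ 2) * f (n - j ^ 2) = 0)
    (hg' : ∀ n > 0, ∑ j ∈ Icc (-n) n, (n - c * j ^ 2) * g (n - j ^ 2) = 0) (n : ℕ) :
    f n = g n := by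
  induction n using Nat.strong_induction_on with
  | _ n ih =>
    rcases Nat.eq_zero_or_pos n with rfl | hn
    · exact_mod_cast h0
    have hn' : (0 : ℤ) < n := by exact_mod_cast hn
    have h := (hf' n hn').trans (hg' n hn').symm
    have hmem : (0 : ℤ) ∈ Icc (-(n : ℤ)) n := by simp
    rw [← add_sum_erase _ _ hmem, ← add_sum_erase _ _ hmem] at h
    have hrest : ∀ j ∈ (Icc (-(n : ℤ)) n).erase 0,
        (n - c * j ^ 2) * f (n - j ^ 2) = (n - c * j ^ 2) * g (n - j ^ 2) := by
      intro j hj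
      have hj2 : 0 < j ^ 2 := by
        have := (mem_erase.1 hj).1
        positivity
      congr 1
      rcases lt_or_ge ((n : ℤ) - j ^ 2) 0 with hlt | hge
      · rw [hf _ hlt, hg _ hlt]
      · have := ih ((n : ℤ) - j ^ 2).toNat (by lia)
        rwa [Int.toNat_of_nonneg hge] at this
    rw [sum_congr rfl hrest, add_left_inj] at h
    simpa [hn.ne'] using h

theorem card_sphere_six (n : ℕ) : (#(sphere 6 n) : ℤ) = divisorSum n := by
  refine eq_of_recurrence 7 (f := fun m => (#(sphere 6 m) : ℤ)) (g := divisorSum) ?_ ?_ ?_ ?_ ?_ n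
  · intro m hm
    simp [sphere_of_neg hm]
  · intro m hm
    simp [divisorSum, divisorPart_of_nonpos hm.le, hm.ne]
  · simp [card_sphere_zero, divisorSum, divisorPart_of_nonpos]
  · intro n _
    exact_mod_cast sum_card_sphere 6 n
  · exact fun n hn => sum_divisorSum hn

lemma r6_eq_card_sphere (n : ℕ) : r6 n = #(sphere 6 n) := by
  rw [r6, ← Nat.card_eq_finsetCard]
  simp only [mem_sphere]

/-- The six-square theorem of Jacobi. -/
theorem r6_eq_sum_divisorsAntidiagonal {n : ℕ} (hn : n ≠ 0) :
    (r6 n : ℤ) = ∑ p ∈ n.divisorsAntidiagonal,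
      χ₄ (p.2 : ZMod 4) * (16 * (p.1 : ℤ) ^ 2 - 4 * (p.2 : ℤ) ^ 2) := by
  rw [r6_eq_card_sphere, card_sphere_six, divisorSum, if_neg (by exact_mod_cast hn), zero_add,
    divisorPart, mul_sum]
  symm
  refine sum_nbij' (fun p => ((p.1 : ℤ), (p.2 : ℤ))) (fun p => (p.1.toNat, p.2.toNat))
    ?_ ?_ ?_ ?_ ?_
  · rintro ⟨a, b⟩ h
    simp only [Nat.mem_divisorsAntidiagonal, mem_filter, mem_product, mem_Icc] at h ⊢
    obtain ⟨rfl, h⟩ := h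
    have ha : 0 < a := Nat.pos_of_ne_zero (by rintro rfl; simp at h)
    have hb : 0 < b := Nat.pos_of_ne_zero (by rintro rfl; simp at h)
    refine ⟨⟨⟨by exact_mod_cast ha, ?_⟩, by exact_mod_cast hb, ?_⟩, by push_cast; ring⟩
    · exact_mod_cast Nat.le_mul_of_pos_right a hb
    · exact_mod_cast Nat.le_mul_of_pos_left b ha
  · rintro ⟨a, b⟩ h
    simp only [Nat.mem_divisorsAntidiagonal, mem_filter, mem_product, mem_Icc] at h ⊢
    refine ⟨?_, hn⟩
    zify
    rw [Int.toNat_of_nonneg (by lia), Int.toNat_of_nonneg (by lia), h.2]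
  · simp
  · rintro ⟨a, b⟩ h
    simp only [mem_filter, mem_product, mem_Icc] at h
    simp only [Prod.mk.injEq]
    lia
  · rintro ⟨a, b⟩ -
    push_cast
    ring

lemma eq_chi4 {χ : DirichletCharacter ℂ 4} (hχ : χ ≠ 1) (a : ZMod 4) : χ a = (χ₄ a : ℂ) := by
  have h3 : χ 3 = -1 := by
    have h : χ 3 * χ 3 = 1 := by
      rw [← map_mul, show (3 : ZMod 4) * 3 = 1 by decide, map_one]
    refine (mul_self_eq_one_iff.1 h).resolve_left fun h3 => hχ ?_
    refine MulChar.ext fun u => ?_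
    have hu : ∀ u : (ZMod 4)ˣ, (u : ZMod 4) = 1 ∨ (u : ZMod 4) = 3 := by decide
    rw [MulChar.one_apply_coe]
    rcases hu u with h | h <;> simp [h, h3]
  have hnu : ∀ a : ZMod 4, ¬ IsUnit a → χ a = (χ₄ a : ℂ) := fun a ha => by
    rw [χ.map_nonunit ha, MulChar.map_nonunit _ ha, Int.cast_zero]
  have ha : a = 1 ∨ a = 3 ∨ ¬ IsUnit a := by revert a; decide
  rcases ha with rfl | rfl | ha
  · simp
  · rw [h3, show χ₄ 3 = -1 by decide]
    simp
  · exact hnu a ha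

lemma term_sq_mul (f : ℕ → ℂ) (s : ℂ) :
    LSeries.term (fun n => (n : ℂ) ^ 2 * f n) s = LSeries.term f (s - 2) := by
  ext n
  rcases eq_or_ne n 0 with rfl | hn
  · simp
  · have hn' : (n : ℂ) ≠ 0 := by exact_mod_cast hn
    rw [LSeries.term_of_ne_zero hn, LSeries.term_of_ne_zero hn, Complex.cpow_sub _ _ hn',
      Complex.cpow_ofNat]
    have : (n : ℂ) ^ s ≠ 0 := by simp [Complex.cpow_eq_zero_iff, hn']
    field_simp

lemma LSeries_sq_mul (f : ℕ → ℂ) (s : ℂ) :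
    LSeries (fun n => (n : ℂ) ^ 2 * f n) s = LSeries f (s - 2) := by
  rw [LSeries, LSeries, term_sq_mul]

lemma LSeriesSummable_sq_mul {f : ℕ → ℂ} {s : ℂ} (h : LSeriesSummable f (s - 2)) :
    LSeriesSummable (fun n => (n : ℂ) ^ 2 * f n) s := by
  rwa [LSeriesSummable, term_sq_mul]

end SixSquares

open Finset SixSquares in
theorem stmt2 (χ : DirichletCharacter ℂ 4) (hχ : χ ≠ 1) (s : ℂ) (hs : 3 < s.re) :
    LSeries (fun n => (r6 n : ℂ)) s =
      16 * riemannZeta (s - 2) * DirichletCharacter.LFunction χ s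
        - 4 * riemannZeta s * DirichletCharacter.LFunction χ (s - 2) := by
  have hs1 : 1 < s.re := by linarith
  have hs2 : 1 < (s - 2).re := by simp; linarith
  have hχ1 := DirichletCharacter.LSeriesSummable_of_one_lt_re χ hs1
  have hχ2 := LSeriesSummable_sq_mul (DirichletCharacter.LSeriesSummable_of_one_lt_re χ hs2)
  have h1 := LSeriesSummable_one_iff.2 hs1
  have h2 := LSeriesSummable_sq_mul (LSeriesSummable_one_iff.2 hs2)
  rw [DirichletCharacter.LFunction_eq_LSeries χ hs1, DirichletCharacter.LFunction_eq_LSeries χ hs2,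
    ← LSeries_one_eq_riemannZeta hs1, ← LSeries_one_eq_riemannZeta hs2, mul_assoc, mul_assoc,
    ← LSeries_sq_mul 1, ← LSeries_sq_mul (fun n => χ n), ← LSeries_convolution' h2 hχ1,
    ← LSeries_convolution' h1 hχ2, ← LSeries_smul, ← LSeries_smul,
    ← LSeries_sub]
  · refine LSeries_congr (fun {n} hn => ?_) s
    have h := congrArg (Int.cast (R := ℂ)) (r6_eq_sum_divisorsAntidiagonal hn)
    simp only [Pi.sub_apply, Pi.smul_apply, LSeries.convolution_def, smul_eq_mul, mul_sum,
      ← sum_sub_distrib]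
    push_cast at h
    rw [h]
    refine sum_congr rfl fun p _ => ?_
    rw [eq_chi4 hχ]
    simp only [Pi.one_apply]
    ring
  · exact (h2.convolution hχ1).smul 16
  · exact (h1.convolution hχ2).smul 4
end

section
/- There exist constants C > 0 and T_0 > 0 such that for every T ≥ T_0 there exists T* ∈ [T, T + T^{1/3}] with |ζ(σ + iT*)| ≤ exp(C·(log log T)^2) uniformly for all σ with 1/2 ≤ σ ≤ 2, where ζ is the Riemann zeta function. -/
open Complex

/-- The function `1 / (exp (i d) - 1)` for real `d`, written through the half-angle cotangent. -/
noncomputable def invExpSubOne (d : ℝ) : ℂ :=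
  -(1 / 2) - (Real.cos (d / 2) / Real.sin (d / 2) / 2 : ℝ) * I

lemma mul_invExpSubOne {d : ℝ} (h : Real.sin (d / 2) ≠ 0) :
    (cexp (d * I) - 1) * invExpSubOne d = 1 := by
  have h1 : cexp (d * I) = (Real.cos (d / 2) + Real.sin (d / 2) * I) ^ 2 := by
    rw [ofReal_cos, ofReal_sin, ← Complex.exp_mul_I, ← Complex.exp_nat_mul]
    congr 1
    push_cast
    ring
  have h2 : ((Real.sin (d / 2) : ℝ) : ℂ) ≠ 0 := by exact_mod_cast h
  have h3 : ((Real.sin (d / 2) : ℝ) : ℂ) ^ 2 + ((Real.cos (d / 2) : ℝ) : ℂ) ^ 2 = 1 := by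
    exact_mod_cast Real.sin_sq_add_cos_sq (d / 2)
  rw [h1, invExpSubOne]
  push_cast only [ofReal_div, ofReal_ofNat]
  generalize ((Real.sin (d / 2) : ℝ) : ℂ) = x at *
  generalize ((Real.cos (d / 2) : ℝ) : ℂ) = y at *
  field_simp
  have hI := I_sq
  linear_combination (x - y * I) * h3 + (x ^ 2 * (-x - y * I) - 2 * x * y ^ 2) * hI

lemma div_pi_le_sin_half {d θ : ℝ} (h1 : θ ≤ d) (h2 : d ≤ 2 * Real.pi - θ) (hθ : 0 < θ) :
    θ / Real.pi ≤ Real.sin (d / 2) := by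
  have hpi := Real.pi_pos
  have key : ∀ x : ℝ, θ / 2 ≤ x → x ≤ Real.pi / 2 → θ / Real.pi ≤ Real.sin x := by
    intro x hx hx2
    have := Real.mul_le_sin (by linarith : 0 ≤ x) hx2
    refine le_trans ?_ this
    rw [div_mul_eq_mul_div]
    gcongr
    linarith
  rcases le_total (d / 2) (Real.pi / 2) with h | h
  · exact key _ (by linarith) h
  · rw [← Real.sin_pi_sub]
    exact key _ (by linarith) (by linarith)

lemma abs_cot_half_le {d θ : ℝ} (h1 : θ ≤ d) (h2 : d ≤ 2 * Real.pi - θ) (hθ : 0 < θ) :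
    |Real.cos (d / 2) / Real.sin (d / 2)| ≤ Real.pi / θ := by
  have h := div_pi_le_sin_half h1 h2 hθ
  have hp : 0 < θ / Real.pi := div_pos hθ Real.pi_pos
  rw [abs_div, abs_of_pos (hp.trans_le h)]
  calc |Real.cos (d / 2)| / Real.sin (d / 2) ≤ 1 / (θ / Real.pi) :=
        div_le_div₀ zero_le_one (Real.abs_cos_le_one _) hp h
    _ = Real.pi / θ := one_div_div _ _

lemma norm_invExpSubOne_le {d θ : ℝ} (h1 : θ ≤ d) (h2 : d ≤ 2 * Real.pi - θ) (hθ : 0 < θ) :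
    ‖invExpSubOne d‖ ≤ Real.pi / θ := by
  have hc := abs_cot_half_le h1 h2 hθ
  have h3 : 1 ≤ Real.pi / θ := by
    rw [le_div_iff₀ hθ]; linarith
  rw [invExpSubOne]
  refine (norm_sub_le _ _).trans ?_
  rw [norm_mul, norm_I, norm_real, Real.norm_eq_abs, abs_div]
  norm_num
  linarith

lemma norm_invExpSubOne_sub_le {d e : ℝ} (he : 0 < e) (hed : e ≤ d) (hd : d < 2 * Real.pi) :
    ‖invExpSubOne d - invExpSubOne e‖ ≤
      Real.cos (e / 2) / Real.sin (e / 2) / 2 - Real.cos (d / 2) / Real.sin (d / 2) / 2 := by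
  have h1 : 0 < Real.sin (e / 2) := Real.sin_pos_of_pos_of_lt_pi (by linarith) (by linarith)
  have h2 : 0 < Real.sin (d / 2) := Real.sin_pos_of_pos_of_lt_pi (by linarith) (by linarith)
  have h3 : 0 ≤ Real.sin (d / 2 - e / 2) :=
    Real.sin_nonneg_of_nonneg_of_le_pi (by linarith) (by linarith)
  have h4 : Real.cos (e / 2) / Real.sin (e / 2) / 2 - Real.cos (d / 2) / Real.sin (d / 2) / 2
      = Real.sin (d / 2 - e / 2) / (2 * Real.sin (e / 2) * Real.sin (d / 2)) := by
    rw [Real.sin_sub]; field_simp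
  have h5 : invExpSubOne d - invExpSubOne e =
      ((Real.cos (e / 2) / Real.sin (e / 2) / 2 - Real.cos (d / 2) / Real.sin (d / 2) / 2 : ℝ) : ℂ)
        * I := by
    rw [invExpSubOne, invExpSubOne]; push_cast; ring
  rw [h5, norm_mul, norm_I, mul_one, norm_real, Real.norm_eq_abs, abs_of_nonneg]
  rw [h4]
  positivity

/-- **Kusmin–Landau inequality**: an exponential sum whose phase increments are decreasing and
stay at distance at least `θ` from `2πℤ` is `O(1 / θ)`. -/
theorem norm_sum_exp_le_of_antitone_diff {φ : ℕ → ℝ} {a b : ℕ} {θ : ℝ} (hθ : 0 < θ)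
    (hanti : ∀ n, a ≤ n → n + 1 < b → φ (n + 2) - φ (n + 1) ≤ φ (n + 1) - φ n)
    (hlo : ∀ n, a ≤ n → n < b → θ ≤ φ (n + 1) - φ n)
    (hhi : ∀ n, a ≤ n → n < b → φ (n + 1) - φ n ≤ 2 * Real.pi - θ) :
    ‖∑ n ∈ Finset.Ico a b, cexp (φ n * I)‖ ≤ 3 * Real.pi / θ := by
  have hpi := Real.pi_pos
  rcases Nat.lt_or_ge a b with hab | hab
  swap
  · rw [Finset.Ico_eq_empty_of_le hab]; simp; positivity
  set E : ℕ → ℂ := fun n => cexp (φ n * I) with hE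
  set d : ℕ → ℝ := fun n => φ (n + 1) - φ n with hd
  have hnE : ∀ n, ‖E n‖ = 1 := fun n => norm_exp_ofReal_mul_I _
  have hEc : ∀ n, a ≤ n → n < b → E n = (E (n + 1) - E n) * invExpSubOne (d n) := by
    intro n h1 h2
    have hs : Real.sin (d n / 2) ≠ 0 :=
      ((div_pos hθ hpi).trans_le (div_pi_le_sin_half (hlo n h1 h2) (hhi n h1 h2) hθ)).ne'
    have h3 : E (n + 1) = E n * cexp (d n * I) := by
      simp only [hE, hd, ← Complex.exp_add]
      congr 1; push_cast; ring
    rw [h3]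
    linear_combination (-E n) * mul_invExpSubOne hs
  have key : ∀ m, a + 1 ≤ m → m ≤ b →
      ‖∑ n ∈ Finset.Ico a m, E n - E m * invExpSubOne (d (m - 1))‖ ≤
      Real.pi / θ + (Real.cos (d (m - 1) / 2) / Real.sin (d (m - 1) / 2) / 2
        - Real.cos (d a / 2) / Real.sin (d a / 2) / 2) := by
    intro m hm
    induction m, hm using Nat.le_induction with
    | base =>
      intro hb
      rw [Nat.Ico_succ_singleton, Finset.sum_singleton, Nat.add_sub_cancel, sub_self, add_zero]
      have : E a - E (a + 1) * invExpSubOne (d a) = - (E a * invExpSubOne (d a)) := by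
        linear_combination hEc a le_rfl hab
      rw [this, norm_neg, norm_mul, hnE, one_mul]
      exact norm_invExpSubOne_le (hlo a le_rfl hab) (hhi a le_rfl hab) hθ
    | succ m hm ih =>
      intro hb
      have ih' := ih (by lia)
      obtain ⟨k, rfl⟩ : ∃ k, m = k + 1 := ⟨m - 1, by lia⟩
      simp only [Nat.add_sub_cancel] at ih' ⊢
      have h1 : ∑ n ∈ Finset.Ico a (k + 1 + 1), E n - E (k + 1 + 1) * invExpSubOne (d (k + 1)) =
          (∑ n ∈ Finset.Ico a (k + 1), E n - E (k + 1) * invExpSubOne (d k)) +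
            E (k + 1) * (invExpSubOne (d k) - invExpSubOne (d (k + 1))) := by
        rw [Finset.sum_Ico_succ_top (by lia)]
        linear_combination hEc (k + 1) (by lia) (by lia)
      have h2 := norm_invExpSubOne_sub_le (d := d k) (e := d (k + 1))
        (hθ.trans_le (hlo _ (by lia) (by lia))) (hanti k (by lia) (by lia))
        (by have := hhi k (by lia) (by lia); simp only [hd]; linarith)
      rw [h1]
      refine (norm_add_le _ _).trans ?_
      rw [norm_mul, hnE, one_mul]
      linarith
  have h1 := key b hab le_rfl
  have h2 := norm_invExpSubOne_le (hlo (b - 1) (by lia) (by lia)) (hhi (b - 1) (by lia) (by lia)) hθ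
  have h3 := abs_cot_half_le (hlo (b - 1) (by lia) (by lia)) (hhi (b - 1) (by lia) (by lia)) hθ
  have h4 := abs_cot_half_le (hlo a le_rfl hab) (hhi a le_rfl hab) hθ
  have h5 := (abs_le.1 h4).1
  have h6 := (abs_le.1 h3).2
  have h7 : ‖∑ n ∈ Finset.Ico a b, E n‖ ≤
      ‖∑ n ∈ Finset.Ico a b, E n - E b * invExpSubOne (d (b - 1))‖ +
        ‖invExpSubOne (d (b - 1))‖ := by
    have := norm_add_le (∑ n ∈ Finset.Ico a b, E n - E b * invExpSubOne (d (b - 1)))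
      (E b * invExpSubOne (d (b - 1)))
    rwa [sub_add_cancel, norm_mul, hnE, one_mul] at this
  have h8 : 3 * Real.pi / θ = 3 * (Real.pi / θ) := by ring
  rw [h8]
  simp only [hd] at *
  linarith

lemma Finset.exists_eq_Ico_of_ordConnected {S : Finset ℕ}
    (h : ∀ x ∈ S, ∀ y ∈ S, ∀ z, x ≤ z → z ≤ y → z ∈ S) : ∃ p q, S = Finset.Ico p q := by
  rcases S.eq_empty_or_nonempty with rfl | hS
  · exact ⟨0, 0, by simp⟩
  · refine ⟨S.min' hS, S.max' hS + 1, ?_⟩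
    ext z
    rw [Finset.mem_Ico, Nat.lt_succ_iff]
    exact ⟨fun hz => ⟨S.min'_le z hz, S.le_max' z hz⟩,
      fun hz => h _ (S.min'_mem hS) _ (S.max'_mem hS) z hz.1 hz.2⟩

/-- The level sets of a decreasing sequence restricted to an interval are intervals. -/
lemma exists_filter_Ico_eq_Ico {d : ℕ → ℝ} {a b : ℕ}
    (hd : ∀ m n, a ≤ m → m ≤ n → n < b → d n ≤ d m) (x y : ℝ) :
    ∃ p q, {n ∈ Finset.Ico a b | x ≤ d n ∧ d n < y} = Finset.Ico p q := by
  apply Finset.exists_eq_Ico_of_ordConnected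
  intro u hu v hv z huz hzv
  simp only [Finset.mem_filter, Finset.mem_Ico] at *
  have h1 := hd u z (by lia) huz (by lia)
  have h2 := hd z v (by lia) hzv (by lia)
  exact ⟨⟨by lia, by lia⟩, by linarith, by linarith⟩

lemma card_filter_Ico_le_of_diff_ge {d : ℕ → ℝ} {a b : ℕ} {lam : ℝ} (hlam : 0 < lam)
    (hd : ∀ n, a ≤ n → n + 1 < b → d (n + 1) + lam ≤ d n) {x y L : ℝ} (hxy : y ≤ x + L)
    (hL : 0 ≤ L) :
    ((Finset.card {n ∈ Finset.Ico a b | x ≤ d n ∧ d n < y} : ℕ) : ℝ) ≤ L / lam + 1 := by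
  have hgap : ∀ m n, a ≤ m → m ≤ n → n < b → d n + (n - m : ℝ) * lam ≤ d m := by
    intro m n hm hmn
    induction n, hmn using Nat.le_induction with
    | base => intro _; simp
    | succ n hmn ih =>
      intro hb
      have h1 := ih (by lia)
      have h2 := hd n (by lia) hb
      push_cast
      linarith
  obtain ⟨p, q, hpq⟩ := exists_filter_Ico_eq_Ico
    (fun m n h1 h2 h3 => by
      have := hgap m n h1 h2 h3
      have h4 : (m : ℝ) ≤ n := by exact_mod_cast h2
      nlinarith : ∀ m n, a ≤ m → m ≤ n → n < b → d n ≤ d m) x y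
  rw [hpq, Nat.card_Ico]
  rcases Nat.lt_or_ge p q with h | h
  · have hp : p ∈ Finset.Ico p q := by simp [h]
    have hq : q - 1 ∈ Finset.Ico p q := by simp; lia
    rw [← hpq] at hp hq
    simp only [Finset.mem_filter, Finset.mem_Ico] at hp hq
    have h1 := hgap p (q - 1) hp.1.1 (by lia) hq.1.2
    have h2 : ((q - p : ℕ) : ℝ) = ((q - 1 : ℕ) : ℝ) - p + 1 := by
      obtain ⟨k, rfl⟩ : ∃ k, q = p + k + 1 := ⟨q - p - 1, by lia⟩
      have e1 : p + k + 1 - p = k + 1 := by lia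
      have e2 : p + k + 1 - 1 = p + k := by lia
      rw [e1, e2]; push_cast; ring
    rw [h2, add_le_add_iff_right, le_div_iff₀ hlam]
    linarith
  · rw [Nat.sub_eq_zero_of_le h]
    simp; positivity

/-- **Van der Corput's second derivative test**, in terms of the increments of the phase. -/
theorem norm_sum_exp_le_of_second_diff {φ : ℕ → ℝ} {a b : ℕ} {lam Δ : ℝ} (hlam : 0 < lam)
    (hΔ : 0 ≤ Δ)
    (hd : ∀ n, a ≤ n → n + 1 < b → φ (n + 2) - φ (n + 1) + lam ≤ φ (n + 1) - φ n)
    (hlo : ∀ n, a ≤ n → n < b → 0 ≤ φ (n + 1) - φ n)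
    (hhi : ∀ n, a ≤ n → n < b → φ (n + 1) - φ n ≤ Δ) :
    ‖∑ n ∈ Finset.Ico a b, cexp (φ n * I)‖ ≤ (Δ + 1) * (5 + 12 / √lam) := by
  have hpi := Real.pi_pos
  have hpi3 := Real.pi_gt_three
  have hpi4 := Real.pi_lt_d2
  set E : ℕ → ℂ := fun n => cexp (φ n * I) with hE
  set d : ℕ → ℝ := fun n => φ (n + 1) - φ n with hd_def
  have hnE : ∀ n, ‖E n‖ = 1 := fun n => norm_exp_ofReal_mul_I _
  have hsq : 0 < √lam := Real.sqrt_pos.2 hlam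
  set θ : ℝ := min (√lam) Real.pi with hθ_def
  have hθ : 0 < θ := lt_min hsq hpi
  have hd' : ∀ n, a ≤ n → n + 1 < b → d (n + 1) + lam ≤ d n := hd
  have hmono : ∀ m n, a ≤ m → m ≤ n → n < b → d n ≤ d m := by
    intro m n hm hmn
    induction n, hmn using Nat.le_induction with
    | base => intro _; exact le_rfl
    | succ n hmn ih =>
      intro hb
      have h1 := ih (by lia)
      have h2 := hd' n (by lia) hb
      linarith
  have hcount : ∀ x y : ℝ, y ≤ x + θ →
      ‖∑ n ∈ Finset.Ico a b with x ≤ d n ∧ d n < y, E n‖ ≤ 1 / √lam + 1 := by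
    intro x y hxy
    refine (norm_sum_le _ _).trans ?_
    simp only [hnE, Finset.sum_const, nsmul_eq_mul, mul_one]
    refine (card_filter_Ico_le_of_diff_ge hlam hd' hxy hθ.le).trans ?_
    refine add_le_add ?_ le_rfl
    rw [div_le_div_iff₀ hlam hsq, one_mul]
    calc θ * √lam ≤ √lam * √lam := by gcongr; exact min_le_left _ _
      _ = lam := Real.mul_self_sqrt hlam.le
  have hmid : ∀ k : ℕ, ‖∑ n ∈ Finset.Ico a b with
      2 * Real.pi * k + θ ≤ d n ∧ d n < 2 * Real.pi * (k + 1) - θ, E n‖ ≤ 10 / √lam + 3 := by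
    intro k
    obtain ⟨p, q, hpq⟩ := exists_filter_Ico_eq_Ico hmono (2 * Real.pi * k + θ)
      (2 * Real.pi * (k + 1) - θ)
    have hmem : ∀ n, p ≤ n → n < q → (a ≤ n ∧ n < b) ∧
        2 * Real.pi * k + θ ≤ d n ∧ d n < 2 * Real.pi * (k + 1) - θ := by
      intro n h1 h2
      have : n ∈ Finset.Ico p q := by simp [h1, h2]
      rw [← hpq] at this
      simpa using this
    rw [hpq]
    have hshift : ∀ n : ℕ, E n = cexp ((φ n - 2 * Real.pi * k * n : ℝ) * I) := by
      intro n
      simp only [hE]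
      rw [Complex.exp_eq_exp_iff_exists_int]
      exact ⟨k * n, by push_cast; ring⟩
    simp only [hshift]
    refine (norm_sum_exp_le_of_antitone_diff (θ := θ) hθ ?_ ?_ ?_).trans ?_
    · intro n h1 h2
      have h3 := hd' n (hmem n h1 (by lia)).1.1 (hmem (n + 1) (by lia) h2).1.2
      simp only [hd_def] at h3
      push_cast
      linarith
    · intro n h1 h2
      have h3 := (hmem n h1 h2).2.1
      simp only [hd_def] at h3
      push_cast
      linarith
    · intro n h1 h2
      have h3 := (hmem n h1 h2).2.2
      simp only [hd_def] at h3
      push_cast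
      linarith
    · rcases min_choice (√lam) Real.pi with h | h
      · rw [hθ_def, h]
        have : 3 * Real.pi / √lam ≤ 10 / √lam := by gcongr; linarith
        linarith
      · rw [hθ_def, h, mul_div_assoc, div_self hpi.ne']
        have : 0 ≤ 10 / √lam := by positivity
        linarith
  have hfib : ∀ k : ℕ, ‖∑ n ∈ Finset.Ico a b with ⌊d n / (2 * Real.pi)⌋₊ = k, E n‖ ≤
      5 + 12 / √lam := by
    intro k
    have hθpi : θ ≤ Real.pi := min_le_right _ _
    have hsplit : ∑ n ∈ Finset.Ico a b with ⌊d n / (2 * Real.pi)⌋₊ = k, E n =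
        ∑ n ∈ Finset.Ico a b with 2 * Real.pi * k ≤ d n ∧ d n < 2 * Real.pi * k + θ, E n +
        ∑ n ∈ Finset.Ico a b with
          2 * Real.pi * k + θ ≤ d n ∧ d n < 2 * Real.pi * (k + 1) - θ, E n +
        ∑ n ∈ Finset.Ico a b with
          2 * Real.pi * (k + 1) - θ ≤ d n ∧ d n < 2 * Real.pi * (k + 1), E n := by
      simp only [Finset.sum_filter, ← Finset.sum_add_distrib]
      refine Finset.sum_congr rfl fun n hn => ?_
      rw [Finset.mem_Ico] at hn
      have hiff : ⌊d n / (2 * Real.pi)⌋₊ = k ↔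
          2 * Real.pi * k ≤ d n ∧ d n < 2 * Real.pi * (k + 1) := by
        rw [Nat.floor_eq_iff (div_nonneg (hlo n hn.1 hn.2) (by positivity)),
          le_div_iff₀ (by positivity), div_lt_iff₀ (by positivity), mul_comm (k : ℝ),
          mul_comm ((k : ℝ) + 1)]
      simp only [hiff]
      have hk : 2 * Real.pi * ((k : ℝ) + 1) = 2 * Real.pi * k + 2 * Real.pi := by ring
      rw [hk]
      generalize 2 * Real.pi * (k : ℝ) = x
      split_ifs <;> first | (simp; done) | (exfalso; grind)
    rw [hsplit]
    have h1 := hcount (2 * Real.pi * k) (2 * Real.pi * k + θ) le_rfl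
    have h2 := hmid k
    have h3 := hcount (2 * Real.pi * (k + 1) - θ) (2 * Real.pi * (k + 1)) (by linarith)
    refine (norm_add₃_le).trans ?_
    have h4 : 12 / √lam = 10 / √lam + 1 / √lam + 1 / √lam := by ring
    linarith
  have hmaps : ∀ n ∈ Finset.Ico a b,
      ⌊d n / (2 * Real.pi)⌋₊ ∈ Finset.range (⌊Δ / (2 * Real.pi)⌋₊ + 1) := by
    intro n hn
    rw [Finset.mem_Ico] at hn
    rw [Finset.mem_range, Nat.lt_succ_iff]
    gcongr
    exact hhi n hn.1 hn.2
  rw [← Finset.sum_fiberwise_of_maps_to hmaps]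
  refine (norm_sum_le_of_le _ fun k _ => hfib k).trans ?_
  rw [Finset.sum_const, Finset.card_range, nsmul_eq_mul]
  gcongr
  push_cast
  gcongr
  refine (Nat.floor_le (by positivity)).trans (div_le_self hΔ (by linarith))

/-- **Abel's inequality** for increasing weights with values in `[0, 1]`. -/
lemma norm_sum_mul_le_of_monotone {E : ℕ → ℂ} {w : ℕ → ℝ} {a b : ℕ} {B : ℝ}
    (hw0 : ∀ n, a ≤ n → n < b → 0 ≤ w n) (hw1 : ∀ n, a ≤ n → n < b → w n ≤ 1)
    (hw : ∀ n, a ≤ n → n + 1 < b → w n ≤ w (n + 1)) (hB : 0 ≤ B)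
    (hE : ∀ m, a ≤ m → m ≤ b → ‖∑ n ∈ Finset.Ico a m, E n‖ ≤ B) :
    ‖∑ n ∈ Finset.Ico a b, (w n : ℂ) * E n‖ ≤ 2 * B := by
  rcases Nat.lt_or_ge a b with hab | hab
  swap
  · rw [Finset.Ico_eq_empty_of_le hab]; simp; positivity
  have key : ∀ m, a + 1 ≤ m → m ≤ b →
      ‖∑ n ∈ Finset.Ico a m, (w n : ℂ) * E n - w (m - 1) * ∑ n ∈ Finset.Ico a m, E n‖ ≤
        (w (m - 1) - w a) * B := by
    intro m hm
    induction m, hm using Nat.le_induction with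
    | base => intro _; simp
    | succ m hm ih =>
      intro hb
      have ih' := ih (by lia)
      obtain ⟨k, rfl⟩ : ∃ k, m = k + 1 := ⟨m - 1, by lia⟩
      simp only [Nat.add_sub_cancel] at ih' ⊢
      have h1 : ∑ n ∈ Finset.Ico a (k + 1 + 1), (w n : ℂ) * E n
            - w (k + 1) * ∑ n ∈ Finset.Ico a (k + 1 + 1), E n =
          (∑ n ∈ Finset.Ico a (k + 1), (w n : ℂ) * E n - w k * ∑ n ∈ Finset.Ico a (k + 1), E n) -
            ((w (k + 1) - w k : ℝ) : ℂ) * ∑ n ∈ Finset.Ico a (k + 1), E n := by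
        rw [Finset.sum_Ico_succ_top (by lia), Finset.sum_Ico_succ_top (by lia : a ≤ k + 1) E]
        push_cast
        ring
      rw [h1]
      refine (norm_sub_le _ _).trans ?_
      have h2 := hw k (by lia) (by lia)
      rw [norm_mul, norm_real, Real.norm_eq_abs, abs_of_nonneg (by linarith)]
      have h3 := hE (k + 1) (by lia) (by lia)
      have h4 := mul_le_mul_of_nonneg_left h3 (sub_nonneg.2 h2)
      linarith
  have h1 := key b hab le_rfl
  have h2 := hw0 (b - 1) (by lia) (by lia)
  have h3 := hw1 (b - 1) (by lia) (by lia)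
  have h4 := hw0 a le_rfl hab
  have h5 := hE b hab.le le_rfl
  have h6 := norm_add_le (∑ n ∈ Finset.Ico a b, (w n : ℂ) * E n
    - w (b - 1) * ∑ n ∈ Finset.Ico a b, E n) (w (b - 1) * ∑ n ∈ Finset.Ico a b, E n)
  rw [sub_add_cancel, norm_mul, norm_real, Real.norm_eq_abs, abs_of_nonneg h2] at h6
  have h7 := mul_le_mul h3 h5 (norm_nonneg _) zero_le_one
  have h8 : (w (b - 1) - w a) * B ≤ 1 * B := by gcongr; linarith
  linarith

lemma half_le_log_one_add {x : ℝ} (h0 : 0 ≤ x) (h1 : x ≤ 1) : x / 2 ≤ Real.log (1 + x) := by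
  have h := Real.one_sub_inv_le_log_of_pos (by linarith : 0 < 1 + x)
  refine le_trans ?_ h
  rw [← sub_nonneg]
  have : 1 - (1 + x)⁻¹ - x / 2 = x * (1 - x) / (2 * (1 + x)) := by
    field_simp
    ring
  rw [this]
  have : 0 ≤ 1 - x := by linarith
  positivity

/-- The phase of `((n + r) / n) ^ (-iT)`. -/
noncomputable def shiftPhase (T : ℝ) (r n : ℕ) : ℝ := -(T * Real.log (1 + r / n))

lemma shiftPhase_succ_sub {T : ℝ} {r n : ℕ} (hn : 1 ≤ n) :
    shiftPhase T r (n + 1) - shiftPhase T r n =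
      T * Real.log (1 + r / (n * (n + r + 1))) := by
  have hn' : (0 : ℝ) < n := by exact_mod_cast hn
  have h : Real.log (1 + r / n) =
      Real.log (1 + r / (n * (n + r + 1))) + Real.log (1 + r / (n + 1 : ℝ)) := by
    rw [← Real.log_mul (by positivity) (by positivity)]
    congr 1
    field_simp
    ring
  simp only [shiftPhase]
  push_cast
  rw [h]
  ring

section
variable {T : ℝ} {N r n : ℕ}

lemma shiftPhase_incr_le (hT : 0 < T) (hN : 1 ≤ N) (hn : N ≤ n) :
    shiftPhase T r (n + 1) - shiftPhase T r n ≤ T * r / N ^ 2 := by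
  have hN' : (0 : ℝ) < N := by exact_mod_cast hN
  have hn' : (N : ℝ) ≤ n := by exact_mod_cast hn
  have hn0 : (0 : ℝ) < n := hN'.trans_le hn'
  rw [shiftPhase_succ_sub (by lia), mul_div_assoc]
  gcongr
  refine (Real.log_le_sub_one_of_pos (by positivity)).trans ?_
  rw [add_sub_cancel_left]
  gcongr
  have : (0 : ℝ) ≤ r := by positivity
  nlinarith

lemma le_shiftPhase_incr (hT : 0 < T) (hN : 1 ≤ N) (hr : r ≤ N) (hn : N ≤ n) (hn2 : n < 2 * N) :
    T * r / (12 * N ^ 2) ≤ shiftPhase T r (n + 1) - shiftPhase T r n := by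
  have hN' : (0 : ℝ) < N := by exact_mod_cast hN
  have hn' : (N : ℝ) ≤ n := by exact_mod_cast hn
  have hn2' : (n : ℝ) + 1 ≤ 2 * N := by exact_mod_cast hn2
  have hr' : (r : ℝ) ≤ N := by exact_mod_cast hr
  have hn0 : (0 : ℝ) < n := hN'.trans_le hn'
  have hr0 : (0 : ℝ) ≤ r := by positivity
  rw [shiftPhase_succ_sub (by lia), mul_div_assoc]
  gcongr
  have h1 : (r : ℝ) / (n * (n + r + 1)) ≤ 1 := by
    rw [div_le_one (by positivity)]
    have : (1 : ℝ) ≤ n := by exact_mod_cast (by lia : 1 ≤ n)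
    nlinarith
  refine le_trans ?_ (half_le_log_one_add (by positivity) h1)
  rw [div_div]
  refine div_le_div_of_nonneg_left hr0 (by positivity) ?_
  nlinarith

lemma shiftPhase_incr_gap (hT : 0 < T) (hN : 1 ≤ N) (hr : r ≤ N) (hn : N ≤ n)
    (hn2 : n + 1 < 2 * N) :
    shiftPhase T r (n + 2) - shiftPhase T r (n + 1) + T * r / (36 * N ^ 3) ≤
      shiftPhase T r (n + 1) - shiftPhase T r n := by
  have hN' : (0 : ℝ) < N := by exact_mod_cast hN
  have hn' : (N : ℝ) ≤ n := by exact_mod_cast hn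
  have hn2' : (n : ℝ) + 2 ≤ 2 * N := by exact_mod_cast hn2
  have hr' : (r : ℝ) ≤ N := by exact_mod_cast hr
  have hn0 : (0 : ℝ) < n := hN'.trans_le hn'
  have hn1 : (1 : ℝ) ≤ n := by exact_mod_cast (by lia : 1 ≤ n)
  have hr0 : (0 : ℝ) ≤ r := by positivity
  rw [shiftPhase_succ_sub (by lia), shiftPhase_succ_sub (by lia)]
  push_cast
  set x : ℝ := r / (n * (n + r + 1)) with hx
  set x' : ℝ := r / ((n + 1) * (n + 1 + r + 1)) with hx'
  have hx0 : 0 ≤ x := by positivity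
  have hx'0 : 0 ≤ x' := by positivity
  have hx1 : x ≤ 1 := by
    rw [hx, div_le_one (by positivity)]
    nlinarith
  have hdiff : x - x' = r * (2 * n + r + 2) / (n * (n + 1) * ((n + r + 1) * (n + r + 2))) := by
    rw [hx, hx', show (n : ℝ) + 1 + r + 1 = n + r + 2 by ring]
    field_simp
    ring
  have hge : (r : ℝ) / (18 * N ^ 3) ≤ x - x' := by
    rw [hdiff]
    calc (r : ℝ) / (18 * N ^ 3) = r * (2 * N) / (2 * N * (2 * N) * (3 * N * (3 * N))) := by
          field_simp
          ring
      _ ≤ _ := by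
          gcongr <;> linarith
  have hlog : Real.log (1 + x') + (x - x') / 2 ≤ Real.log (1 + x) := by
    have h1 := Real.one_sub_inv_le_log_of_pos (by positivity : 0 < (1 + x) / (1 + x'))
    rw [Real.log_div (by positivity) (by positivity), inv_div] at h1
    have h2 : 1 - (1 + x') / (1 + x) = (x - x') / (1 + x) := by
      field_simp
      ring
    have h3 : (x - x') / 2 ≤ (x - x') / (1 + x) := by
      have : 0 ≤ (r : ℝ) / (18 * N ^ 3) := by positivity
      gcongr
      · linarith
      · linarith
    linarith
  have h5 : T * r / (36 * N ^ 3) ≤ T * ((x - x') / 2) := by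
    rw [mul_div_assoc]
    refine mul_le_mul_of_nonneg_left ?_ hT.le
    have h6 : (r : ℝ) / (36 * N ^ 3) = r / (18 * N ^ 3) / 2 := by
      rw [div_div]
      ring
    linarith
  nlinarith

lemma norm_sum_shiftPhase_le (hT : 0 < T) (hr1 : 1 ≤ r) (hr : r ≤ N) {m : ℕ} (hm : m ≤ 2 * N) :
    ‖∑ n ∈ Finset.Ico N m, cexp (shiftPhase T r n * I)‖ ≤
      (T * r / N ^ 2 + 1) * (5 + 12 / √(T * r / (36 * N ^ 3))) := by
  have hN' : (0 : ℝ) < N := by exact_mod_cast hr1.trans hr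
  have hr' : (0 : ℝ) < r := by exact_mod_cast hr1
  refine norm_sum_exp_le_of_second_diff (by positivity) (by positivity) ?_ ?_ ?_
  · exact fun n h1 h2 => shiftPhase_incr_gap hT (by lia) hr h1 (by lia)
  · exact fun n h1 h2 => le_trans (by positivity)
      (le_shiftPhase_incr hT (by lia) hr h1 (by lia))
  · exact fun n h1 h2 => shiftPhase_incr_le hT (by lia) h1

lemma norm_sum_shiftPhase_le_of_le_one (hT : 0 < T) (hr1 : 1 ≤ r) (hr : r ≤ N) {m : ℕ}
    (hm : m ≤ 2 * N) (hTr : T * r / N ^ 2 ≤ 1) :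
    ‖∑ n ∈ Finset.Ico N m, cexp (shiftPhase T r n * I)‖ ≤ 120 * (N ^ 2 / (T * r)) := by
  have hN' : (0 : ℝ) < N := by exact_mod_cast hr1.trans hr
  have hr' : (0 : ℝ) < r := by exact_mod_cast hr1
  have hpi := Real.pi_gt_three
  have h12 : T * r / (12 * N ^ 2) = T * r / N ^ 2 / 12 := by field_simp
  refine (norm_sum_exp_le_of_antitone_diff (θ := T * r / (12 * N ^ 2)) (by positivity)
    ?_ ?_ ?_).trans ?_
  · intro n h1 h2
    have h3 := shiftPhase_incr_gap (n := n) hT (by lia) hr h1 (by lia)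
    have : 0 ≤ T * r / (36 * N ^ 3) := by positivity
    linarith
  · exact fun n h1 h2 => le_shiftPhase_incr hT (by lia) hr h1 (by lia)
  · intro n h1 h2
    have h3 := shiftPhase_incr_le (T := T) (r := r) hT (by lia) h1
    linarith
  · have hpi4 := Real.pi_lt_d2
    calc 3 * Real.pi / (T * r / (12 * N ^ 2)) = (36 * Real.pi) * (N ^ 2 / (T * r)) := by
          field_simp
          norm_num
      _ ≤ _ := by gcongr; linarith

/-- The Gaussian weight attached to the pair `(n + r, n)`. -/
noncomputable def shiftWeight (h : ℝ) (r n : ℕ) : ℝ :=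
  Real.exp (-(h ^ 2 * Real.log (1 + r / n) ^ 2 / 4))

lemma shiftWeight_nonneg (h : ℝ) (r n : ℕ) : 0 ≤ shiftWeight h r n := (Real.exp_pos _).le

lemma shiftWeight_le_one (h : ℝ) (r n : ℕ) : shiftWeight h r n ≤ 1 := by
  rw [shiftWeight, Real.exp_le_one_iff]
  have : 0 ≤ h ^ 2 * Real.log (1 + r / n) ^ 2 / 4 := by positivity
  linarith

lemma shiftWeight_mono (h : ℝ) (hn : 1 ≤ n) : shiftWeight h r n ≤ shiftWeight h r (n + 1) := by
  have hn' : (0 : ℝ) < n := by exact_mod_cast hn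
  have h1 : Real.log (1 + r / (n + 1 : ℕ)) ≤ Real.log (1 + r / n) := by
    gcongr
    simp
  have h2 : 0 ≤ Real.log (1 + r / (n + 1 : ℕ)) :=
    Real.log_nonneg (by have : (0 : ℝ) ≤ r / (n + 1 : ℕ) := by positivity
                        linarith)
  unfold shiftWeight
  gcongr

lemma norm_sum_shiftWeight_mul_le {h B : ℝ} {u : ℕ} (hN : 1 ≤ N) (hB : 0 ≤ B)
    (hE : ∀ m ≤ u, ‖∑ n ∈ Finset.Ico N m, cexp (shiftPhase T r n * I)‖ ≤ B) :
    ‖∑ n ∈ Finset.Ico N u, (shiftWeight h r n : ℂ) * cexp (shiftPhase T r n * I)‖ ≤ 2 * B :=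
  norm_sum_mul_le_of_monotone (fun n _ _ => shiftWeight_nonneg h r n)
    (fun n _ _ => shiftWeight_le_one h r n)
    (fun n h1 _ => shiftWeight_mono h (by lia)) hB (fun m _ hm => hE m hm)

lemma norm_sum_shiftWeight_mul_le_one {h ℓ : ℝ} {u : ℕ} (hh : 0 < h) (hℓ : 1 ≤ ℓ) (hN : 1 ≤ N)
    (hr : r ≤ N) (hu : u ≤ 2 * N) (hNT : (N : ℝ) ≤ Real.exp ℓ) (hrl : 8 * ℓ * N ≤ r * h) :
    ‖∑ n ∈ Finset.Ico N u, (shiftWeight h r n : ℂ) * cexp (shiftPhase T r n * I)‖ ≤ 1 := by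
  have hN' : (0 : ℝ) < N := by exact_mod_cast hN
  have hr' : (r : ℝ) ≤ N := by exact_mod_cast hr
  have hw : ∀ n ∈ Finset.Ico N u,
      ‖(shiftWeight h r n : ℂ) * cexp (shiftPhase T r n * I)‖ ≤ (N : ℝ)⁻¹ := by
    intro n hn
    rw [Finset.mem_Ico] at hn
    have hn1 : (N : ℝ) ≤ n := by exact_mod_cast hn.1
    have hn2 : (n : ℝ) ≤ 2 * N := by exact_mod_cast (by lia : n ≤ 2 * N)
    have hn0 : (0 : ℝ) < n := hN'.trans_le hn1
    rw [norm_mul, norm_exp_ofReal_mul_I, mul_one, norm_real, Real.norm_eq_abs,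
      abs_of_nonneg (shiftWeight_nonneg _ _ _)]
    have h1 : (r : ℝ) / n / 2 ≤ Real.log (1 + r / n) :=
      half_le_log_one_add (by positivity) (by rw [div_le_one hn0]; linarith)
    have h2 : 2 * ℓ ≤ h * Real.log (1 + r / n) := by
      calc 2 * ℓ ≤ h * (r / (2 * N) / 2) := by
            rw [div_div, mul_div_assoc', le_div_iff₀ (by positivity)]
            nlinarith
        _ ≤ h * (r / n / 2) := by gcongr
        _ ≤ _ := by gcongr
    have h3 : ℓ ≤ h ^ 2 * Real.log (1 + r / n) ^ 2 / 4 := by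
      rw [← mul_pow]
      nlinarith
    calc shiftWeight h r n ≤ Real.exp (-ℓ) := by
          unfold shiftWeight
          gcongr
      _ = (Real.exp ℓ)⁻¹ := Real.exp_neg _
      _ ≤ (N : ℝ)⁻¹ := by gcongr
  refine (norm_sum_le_of_le _ hw).trans ?_
  rw [Finset.sum_const, Nat.card_Ico, nsmul_eq_mul]
  rw [← div_eq_mul_inv, div_le_one hN']
  exact_mod_cast (by lia : u - N ≤ N)

end

lemma sum_Ico_inv_sqrt_le (n : ℕ) : ∑ r ∈ Finset.Ico 1 (n + 1), (√(r : ℝ))⁻¹ ≤ 2 * √(n : ℝ) := by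
  induction n with
  | zero => simp
  | succ n ih =>
    rw [Finset.sum_Ico_succ_top (by lia)]
    have h1 : (0 : ℝ) < √((n + 1 : ℕ) : ℝ) := Real.sqrt_pos.2 (by positivity)
    have h2 := Real.sq_sqrt (by positivity : (0 : ℝ) ≤ ((n + 1 : ℕ) : ℝ))
    have h3 := Real.sq_sqrt (by positivity : (0 : ℝ) ≤ (n : ℝ))
    have h4 : (√((n + 1 : ℕ) : ℝ))⁻¹ ≤ 2 * √((n + 1 : ℕ) : ℝ) - 2 * √(n : ℝ) := by
      rw [inv_le_iff_one_le_mul₀ h1]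
      push_cast at *
      nlinarith [sq_nonneg (√((n : ℝ) + 1) - √(n : ℝ))]
    linarith

section
variable {h L : ℝ} {N r u : ℕ}

lemma norm_sum_shift_le_of_small (hh : 1 ≤ h) (hL : 1 ≤ L) (hr1 : 1 ≤ r) (hr : r ≤ N)
    (hu : u ≤ 2 * N) (hrL : r * h ≤ L * N) :
    ‖∑ n ∈ Finset.Ico N u, (shiftWeight h r n : ℂ) * cexp (shiftPhase (h ^ 3) r n * I)‖ ≤
      10 + (154 * (h * L ^ 2) + 144 * (√(N ^ 3 / h ^ 3) * (√(r : ℝ))⁻¹)) := by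
  have hN0 : (0 : ℝ) < N := by exact_mod_cast hr1.trans hr
  have hr0 : (0 : ℝ) < r := by exact_mod_cast hr1
  have hr1' : (1 : ℝ) ≤ r := by exact_mod_cast hr1
  have hh0 : 0 < h := by linarith
  have hB := norm_sum_shiftWeight_mul_le (T := h ^ 3) (r := r) (h := h) (u := u)
    (hr1.trans hr) (by positivity)
    (fun m hm => norm_sum_shiftPhase_le (T := h ^ 3) (by positivity) hr1 hr (hm.trans hu))
  refine hB.trans ?_
  set Q : ℝ := √(N ^ 3 / h ^ 3) * (√(r : ℝ))⁻¹ with hQ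
  have hQ0 : 0 ≤ Q := by positivity
  have hQ2 : Q ^ 2 = N ^ 3 / (h ^ 3 * r) := by
    rw [hQ, mul_pow, inv_pow, Real.sq_sqrt (by positivity), Real.sq_sqrt (by positivity)]
    field_simp
  have hsq : 12 / √(h ^ 3 * r / (36 * N ^ 3)) = 72 * Q := by
    have h1 : h ^ 3 * r / (36 * N ^ 3) = ((6 * Q) ^ 2)⁻¹ := by
      rw [mul_pow, hQ2]
      field_simp
      norm_num
    rw [h1, Real.sqrt_inv, Real.sqrt_sq (by positivity)]
    field_simp
    ring
  rw [hsq]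
  set Δ : ℝ := h ^ 3 * r / N ^ 2 with hΔ
  have hΔ0 : 0 ≤ Δ := by positivity
  have hΔ1 : Δ ≤ h * L ^ 2 := by
    rw [hΔ, div_le_iff₀ (by positivity)]
    have h1 : h ≤ L * N := by nlinarith
    calc h ^ 3 * r = h * (h * (r * h)) := by ring
      _ ≤ h * (L * N * (L * N)) := by gcongr
      _ = _ := by ring
  have hΔQ : Δ * Q ≤ h * L ^ 2 := by
    refine le_of_sq_le_sq ?_ (by positivity)
    rw [mul_pow, hQ2]
    calc Δ ^ 2 * (N ^ 3 / (h ^ 3 * r)) = h ^ 2 * ((r * h) / N) := by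
          rw [hΔ]
          field_simp
      _ ≤ h ^ 2 * L ^ 4 := by
          gcongr
          rw [div_le_iff₀ hN0]
          refine hrL.trans ?_
          gcongr
          exact le_self_pow₀ hL (by norm_num)
      _ = _ := by ring
  nlinarith

lemma norm_sum_shift_le_of_large (hh : 1 ≤ h) (hr1 : 1 ≤ r) (hr : r ≤ N)
    (hu : u ≤ 2 * N) (hrL : r * h ≤ L * N) (hN : h ^ 2 * L ≤ N) :
    ‖∑ n ∈ Finset.Ico N u, (shiftWeight h r n : ℂ) * cexp (shiftPhase (h ^ 3) r n * I)‖ ≤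
      240 * (N ^ 2 / h ^ 3) * (r : ℝ)⁻¹ := by
  have hN0 : (0 : ℝ) < N := by exact_mod_cast hr1.trans hr
  have hr0 : (0 : ℝ) < r := by exact_mod_cast hr1
  have hh0 : 0 < h := by linarith
  have hΔ : h ^ 3 * r / N ^ 2 ≤ 1 := by
    rw [div_le_one (by positivity)]
    calc h ^ 3 * r = h ^ 2 * (r * h) := by ring
      _ ≤ h ^ 2 * (L * N) := by gcongr
      _ = h ^ 2 * L * N := by ring
      _ ≤ N * N := by gcongr
      _ = _ := by ring
  have hB := norm_sum_shiftWeight_mul_le (T := h ^ 3) (r := r) (h := h) (u := u)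
    (hr1.trans hr) (by positivity)
    (fun m hm => norm_sum_shiftPhase_le_of_le_one (T := h ^ 3) (by positivity) hr1 hr
      (hm.trans hu) hΔ)
  refine hB.trans (le_of_eq ?_)
  field_simp
  norm_num

end

lemma sum_Ico_inv_le (n : ℕ) :
    ∑ r ∈ Finset.Ico 1 n, (r : ℝ)⁻¹ ≤ 1 + Real.log n := by
  have h1 := harmonic_le_one_add_log n
  refine le_trans ?_ h1
  rw [harmonic_eq_sum_Icc]
  push_cast
  refine Finset.sum_le_sum_of_subset_of_nonneg ?_ (fun _ _ _ => by positivity)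
  intro x
  simp only [Finset.mem_Ico, Finset.mem_Icc]
  lia

theorem sum_norm_shift_le {h ℓ : ℝ} {N u : ℕ} (hh : 1 ≤ h) (hℓ : 1 ≤ ℓ) (hT : h ^ 3 = Real.exp ℓ)
    (hN : 1 ≤ N) (hNT : (N : ℝ) ≤ h ^ 3) (hu : u ≤ 2 * N) :
    ∑ r ∈ Finset.Ico 1 N, ‖∑ n ∈ Finset.Ico N (u - r),
      (shiftWeight h r n : ℂ) * cexp (shiftPhase (h ^ 3) r n * I)‖ ≤ 500 * N * (8 * ℓ) ^ 3 := by
  have hN0 : (0 : ℝ) < N := by exact_mod_cast hN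
  have hh0 : 0 < h := by linarith
  set L : ℝ := 8 * ℓ with hL_def
  have hL : 1 ≤ L := by linarith
  have hL0 : 0 < L := by linarith
  have htail : ∀ r ∈ Finset.Ico 1 N, ¬ (r * h ≤ L * N) → ‖∑ n ∈ Finset.Ico N (u - r),
      (shiftWeight h r n : ℂ) * cexp (shiftPhase (h ^ 3) r n * I)‖ ≤ 1 := by
    intro r hr hrL
    rw [Finset.mem_Ico] at hr
    exact norm_sum_shiftWeight_mul_le_one hh0 hℓ hN hr.2.le (by lia) (by rwa [← hT])
      (not_le.1 hrL).le
  have hNL : (N : ℝ) ≤ N * L ^ 3 := le_mul_of_one_le_right hN0.le (one_le_pow₀ hL)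
  rcases le_total (N : ℝ) (h ^ 2 * L) with hcase | hcase
  · set R : ℕ := ⌊L * N / h⌋₊ with hR
    have hRle : (R : ℝ) ≤ L * N / h := Nat.floor_le (by positivity)
    set g : ℕ → ℝ := fun r => 154 * (h * L ^ 2) + 144 * (√(N ^ 3 / h ^ 3) * (√(r : ℝ))⁻¹) with hg
    have hg0 : ∀ r, 0 ≤ g r := fun r => by positivity
    calc _ ≤ ∑ r ∈ Finset.Ico 1 N, ((10 : ℝ) + if r * h ≤ L * N then g r else 0) := by
          refine Finset.sum_le_sum fun r hr => ?_
          split_ifs with hrL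
          · rw [Finset.mem_Ico] at hr
            exact norm_sum_shift_le_of_small hh hL hr.1 hr.2.le (by lia) hrL
          · linarith [htail r hr hrL]
      _ ≤ 10 * N + ∑ r ∈ Finset.Ico 1 (R + 1), g r := by
          rw [Finset.sum_add_distrib, ← Finset.sum_filter]
          refine add_le_add ?_ ?_
          · rw [Finset.sum_const, Nat.card_Ico, nsmul_eq_mul, mul_comm]
            gcongr
            exact Nat.sub_le _ _
          · refine Finset.sum_le_sum_of_subset_of_nonneg ?_ (fun r _ _ => hg0 r)
            intro r hr
            rw [Finset.mem_filter, Finset.mem_Ico] at hr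
            rw [Finset.mem_Ico, Nat.lt_succ_iff]
            exact ⟨hr.1.1, Nat.le_floor ((le_div_iff₀ hh0).2 hr.2)⟩
      _ ≤ 10 * N + (154 * (N * L ^ 3) + 288 * (N * L ^ 3)) := by
          simp only [hg]
          rw [Finset.sum_add_distrib, Finset.sum_const, Nat.card_Ico, Nat.add_sub_cancel,
            nsmul_eq_mul, ← Finset.mul_sum, ← Finset.mul_sum]
          refine add_le_add le_rfl (add_le_add ?_ ?_)
          · calc (R : ℝ) * (154 * (h * L ^ 2)) ≤ L * N / h * (154 * (h * L ^ 2)) := by gcongr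
              _ = 154 * (N * L ^ 3) := by
                field_simp
          · have h1 : √(N ^ 3 / h ^ 3) * √(R : ℝ) ≤ N * L ^ 3 := by
              refine le_of_sq_le_sq ?_ (by positivity)
              rw [mul_pow, Real.sq_sqrt (by positivity), Real.sq_sqrt (by positivity)]
              calc (N : ℝ) ^ 3 / h ^ 3 * R ≤ N ^ 3 / h ^ 3 * (L * N / h) := by gcongr
                _ = N ^ 2 * L * (N / h ^ 2) ^ 2 := by
                  field_simp
                _ ≤ N ^ 2 * L * L ^ 2 := by
                  gcongr
                  rw [div_le_iff₀ (by positivity)]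
                  linarith
                _ = N ^ 2 * L ^ 3 := by ring
                _ ≤ N ^ 2 * L ^ 6 := by
                  gcongr ?_ * ?_
                  exact pow_le_pow_right₀ hL (by norm_num)
                _ = _ := by ring
            have h2 := sum_Ico_inv_sqrt_le R
            have h3 := mul_le_mul_of_nonneg_left h2 (by positivity : 0 ≤ √((N : ℝ) ^ 3 / h ^ 3))
            linarith
      _ ≤ _ := by linarith
  · calc _ ≤ ∑ r ∈ Finset.Ico 1 N, ((1 : ℝ) + 240 * (N ^ 2 / h ^ 3) * (r : ℝ)⁻¹) := by
          refine Finset.sum_le_sum fun r hr => ?_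
          by_cases hrL : r * h ≤ L * N
          · rw [Finset.mem_Ico] at hr
            linarith [norm_sum_shift_le_of_large hh hr.1 hr.2.le (by lia : u - r ≤ 2 * N) hrL hcase]
          · have : 0 ≤ 240 * (N ^ 2 / h ^ 3) * (r : ℝ)⁻¹ := by positivity
            linarith [htail r hr hrL]
      _ ≤ N + 240 * N * (1 + ℓ) := by
          rw [Finset.sum_add_distrib, ← Finset.mul_sum]
          refine add_le_add ?_ ?_
          · rw [Finset.sum_const, Nat.card_Ico, nsmul_eq_mul, mul_one]
            exact_mod_cast Nat.sub_le _ _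
          · have h1 : (N : ℝ) ^ 2 / h ^ 3 ≤ N := by
              rw [div_le_iff₀ (by positivity), sq]
              gcongr
            have h2 : Real.log N ≤ ℓ := by
              rw [Real.log_le_iff_le_exp hN0, ← hT]
              exact hNT
            have h3 := sum_Ico_inv_le N
            gcongr
            linarith
      _ ≤ _ := by
          have h1 : ℓ ≤ L ^ 3 := by
            have : L ≤ L ^ 3 := le_self_pow₀ hL (by norm_num)
            linarith
          have h2 : (N : ℝ) * ℓ ≤ N * L ^ 3 := by gcongr
          linarith

lemma integral_gaussian_mul_cexp (T h a : ℝ) :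
    ∫ x : ℝ, cexp (-(x : ℂ) ^ 2) * cexp (-((T + h * x) * a : ℝ) * I) =
      √Real.pi * (Real.exp (-(h ^ 2 * a ^ 2 / 4)) * cexp ((-(T * a) : ℝ) * I)) := by
  have key := fourierIntegral_gaussian (b := 1) (by simp) ((-(h * a) : ℝ) : ℂ)
  have hpi : ((Real.pi : ℂ) / 1) ^ (1 / 2 : ℂ) = (√Real.pi : ℝ) := by
    rw [Real.sqrt_eq_rpow, ofReal_cpow Real.pi_pos.le]; simp
  rw [hpi] at key
  have : ∀ x : ℝ, cexp (-(x : ℂ) ^ 2) * cexp (-((T + h * x) * a : ℝ) * I) =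
      cexp ((-(T * a) : ℝ) * I) *
        (cexp (I * ((-(h * a) : ℝ) : ℂ) * x) * cexp (-1 * (x : ℂ) ^ 2)) := by
    intro x
    rw [← Complex.exp_add, ← Complex.exp_add, ← Complex.exp_add]
    congr 1; push_cast; ring
  simp_rw [this]
  rw [MeasureTheory.integral_const_mul, key, ofReal_exp]
  have : cexp (-((-(h * a) : ℝ) : ℂ) ^ 2 / (4 * 1)) =
      cexp ((-(h ^ 2 * a ^ 2 / 4) : ℝ) : ℂ) := by
    congr 1; push_cast; ring
  rw [this]; ring

lemma integrable_gaussian_mul_cexp (T h a : ℝ) :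
    MeasureTheory.Integrable
      fun x : ℝ => cexp (-(x : ℂ) ^ 2) * cexp (-((T + h * x) * a : ℝ) * I) := by
  refine (integrable_exp_neg_mul_sq one_pos).mono' (by fun_prop)
    (Filter.Eventually.of_forall fun x => le_of_eq ?_)
  rw [norm_mul, ← ofReal_neg, norm_exp_ofReal_mul_I, mul_one, neg_one_mul, ← ofReal_pow,
    ← ofReal_neg, ← ofReal_exp, norm_real, Real.norm_of_nonneg (Real.exp_pos _).le]

lemma Finset.sum_Ico_sum_Ico_eq_diag_add {M : Type*} [AddCommMonoid M] (a b : ℕ)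
    (g : ℕ → ℕ → M) :
    ∑ m ∈ Finset.Ico a b, ∑ n ∈ Finset.Ico a b, g m n =
      ∑ n ∈ Finset.Ico a b, g n n +
        (∑ n ∈ Finset.Ico a b, ∑ m ∈ Finset.Ico (n + 1) b, g n m +
          ∑ n ∈ Finset.Ico a b, ∑ m ∈ Finset.Ico (n + 1) b, g m n) := by
  rw [Finset.sum_Ico_Ico_comm' a b fun n m => g m n, ← Finset.sum_add_distrib,
    ← Finset.sum_add_distrib]
  refine Finset.sum_congr rfl fun m hm => ?_
  rw [Finset.mem_Ico] at hm
  rw [← Finset.sum_Ico_consecutive _ hm.1 hm.2.le, Finset.sum_eq_sum_Ico_succ_bot hm.2]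
  abel

lemma Finset.sum_Ico_sum_Ico_succ_eq_sum_shift {M : Type*} [AddCommMonoid M] {N u : ℕ}
    (hu : u ≤ 2 * N) (g : ℕ → ℕ → M) :
    ∑ n ∈ Finset.Ico N u, ∑ m ∈ Finset.Ico (n + 1) u, g n m =
      ∑ r ∈ Finset.Ico 1 N, ∑ n ∈ Finset.Ico N (u - r), g n (n + r) := by
  rw [Finset.sum_sigma', Finset.sum_sigma']
  refine Finset.sum_bij' (fun p _ => ⟨p.2 - p.1, p.1⟩) (fun p _ => ⟨p.2, p.2 + p.1⟩) ?_ ?_ ?_ ?_ ?_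
  · rintro ⟨n, m⟩ h
    simp only [Finset.mem_sigma, Finset.mem_Ico] at h ⊢
    lia
  · rintro ⟨r, n⟩ h
    simp only [Finset.mem_sigma, Finset.mem_Ico] at h ⊢
    lia
  · rintro ⟨n, m⟩ h
    simp only [Finset.mem_sigma, Finset.mem_Ico] at h ⊢
    simp only [Sigma.mk.injEq, heq_eq_eq, true_and]
    lia
  · rintro ⟨r, n⟩ h
    simp
  · rintro ⟨n, m⟩ h
    simp only [Finset.mem_sigma, Finset.mem_Ico] at h ⊢
    congr 1; lia

/-- The exponential sum `∑ n ^ (-it)` over `N ≤ n < u`. -/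
noncomputable def dirichletSum (N u : ℕ) (t : ℝ) : ℂ :=
  ∑ n ∈ Finset.Ico N u, cexp (-(t * Real.log n : ℝ) * I)

@[fun_prop]
lemma continuous_dirichletSum (N u : ℕ) : Continuous (dirichletSum N u) := by
  unfold dirichletSum; fun_prop

lemma normSq_dirichletSum (N u : ℕ) (t : ℝ) :
    ((‖dirichletSum N u t‖ ^ 2 : ℝ) : ℂ) =
      ∑ m ∈ Finset.Ico N u, ∑ n ∈ Finset.Ico N u,
        cexp (-(t * (Real.log m - Real.log n) : ℝ) * I) := by
  rw [← Complex.normSq_eq_norm_sq, ← Complex.mul_conj]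
  simp only [dirichletSum, map_sum]
  rw [Finset.sum_mul_sum]
  refine Finset.sum_congr rfl fun m _ => Finset.sum_congr rfl fun n _ => ?_
  rw [← Complex.exp_conj, ← Complex.exp_add]
  congr 1
  simp only [map_neg, map_mul, conj_ofReal, conj_I]
  push_cast; ring

lemma integral_gaussian_mul_norm_sq_dirichletSum (N u : ℕ) (T h : ℝ) :
    ((∫ x : ℝ, Real.exp (-x ^ 2) * ‖dirichletSum N u (T + h * x)‖ ^ 2 : ℝ) : ℂ) =
      √Real.pi * ∑ m ∈ Finset.Ico N u, ∑ n ∈ Finset.Ico N u,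
        (Real.exp (-(h ^ 2 * (Real.log m - Real.log n) ^ 2 / 4)) : ℂ) *
          cexp ((-(T * (Real.log m - Real.log n)) : ℝ) * I) := by
  have hexp : ∀ x : ℝ, ((Real.exp (-x ^ 2) : ℝ) : ℂ) = cexp (-(x : ℂ) ^ 2) := by
    intro x; push_cast; rfl
  have hfun : ∀ x : ℝ, ((Real.exp (-x ^ 2) * ‖dirichletSum N u (T + h * x)‖ ^ 2 : ℝ) : ℂ) =
      ∑ m ∈ Finset.Ico N u, ∑ n ∈ Finset.Ico N u, cexp (-(x : ℂ) ^ 2) *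
        cexp (-((T + h * x) * (Real.log m - Real.log n) : ℝ) * I) := by
    intro x
    rw [ofReal_mul, normSq_dirichletSum, hexp]
    simp_rw [Finset.mul_sum]
  rw [← integral_complex_ofReal]
  simp_rw [hfun, Finset.mul_sum]
  rw [MeasureTheory.integral_finsetSum]
  · refine Finset.sum_congr rfl fun m _ => ?_
    rw [MeasureTheory.integral_finsetSum]
    · exact Finset.sum_congr rfl fun n _ => integral_gaussian_mul_cexp _ _ _
    · exact fun n _ => integrable_gaussian_mul_cexp T h (Real.log m - Real.log n)
  · exact fun m _ => MeasureTheory.integrable_finsetSum _ fun n _ =>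
      integrable_gaussian_mul_cexp T h (Real.log m - Real.log n)

lemma integral_gaussian_mul_norm_sq_dirichletSum_le {h ℓ : ℝ} {N u : ℕ} (hh : 1 ≤ h) (hℓ : 1 ≤ ℓ)
    (hT : h ^ 3 = Real.exp ℓ) (hN : 1 ≤ N) (hNT : (N : ℝ) ≤ h ^ 3) (hu : u ≤ 2 * N) :
    ∫ x : ℝ, Real.exp (-x ^ 2) * ‖dirichletSum N u (h ^ 3 + h * x)‖ ^ 2 ≤
      √Real.pi * (N + 2 * (500 * N * (8 * ℓ) ^ 3)) := by
  set g : ℕ → ℕ → ℂ := fun m n =>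
    Real.exp (-(h ^ 2 * (Real.log m - Real.log n) ^ 2 / 4)) *
      cexp ((-(h ^ 3 * (Real.log m - Real.log n)) : ℝ) * I) with hg
  have hgauss : ((∫ x : ℝ, Real.exp (-x ^ 2) * ‖dirichletSum N u (h ^ 3 + h * x)‖ ^ 2 : ℝ) : ℂ) =
      √Real.pi * ∑ m ∈ Finset.Ico N u, ∑ n ∈ Finset.Ico N u, g m n := by
    exact integral_gaussian_mul_norm_sq_dirichletSum N u (h ^ 3) h
  have hconj : ∀ m n, g m n = (starRingEnd ℂ) (g n m) := by
    intro m n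
    simp only [hg, map_mul, conj_ofReal, ← Complex.exp_conj, conj_I]
    congr 1
    · congr 3; ring
    · congr 1; push_cast; ring
  have hshift : ∀ r n : ℕ, 1 ≤ n →
      g (n + r) n = (shiftWeight h r n : ℂ) * cexp (shiftPhase (h ^ 3) r n * I) := by
    intro r n hn
    have hn0 : (0 : ℝ) < n := by exact_mod_cast hn
    have : Real.log ((n + r : ℕ) : ℝ) - Real.log n = Real.log (1 + r / n) := by
      rw [← Real.log_div (by positivity) (by positivity)]
      congr 1; push_cast; field_simp
    simp only [hg, this, shiftWeight, shiftPhase]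
  have hoff : ‖∑ n ∈ Finset.Ico N u, ∑ m ∈ Finset.Ico (n + 1) u, g m n‖ ≤
      500 * N * (8 * ℓ) ^ 3 := by
    rw [Finset.sum_Ico_sum_Ico_succ_eq_sum_shift hu fun n m => g m n]
    refine (norm_sum_le _ _).trans ?_
    refine le_of_eq_of_le (Finset.sum_congr rfl fun r _ => ?_)
      (sum_norm_shift_le hh hℓ hT hN hNT hu)
    congr 1
    refine Finset.sum_congr rfl fun n hn => hshift r n ?_
    rw [Finset.mem_Ico] at hn
    lia
  have hoff' : ‖∑ n ∈ Finset.Ico N u, ∑ m ∈ Finset.Ico (n + 1) u, g n m‖ ≤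
      500 * N * (8 * ℓ) ^ 3 := by
    refine le_of_eq_of_le ?_ hoff
    rw [← Complex.norm_conj]
    simp_rw [map_sum, ← hconj]
  have hdiag : ‖∑ n ∈ Finset.Ico N u, g n n‖ ≤ N := by
    have : ∀ n, g n n = 1 := by intro n; simp [hg]
    simp only [this, Finset.sum_const, Nat.card_Ico, nsmul_eq_mul, mul_one, norm_natCast]
    exact_mod_cast (by lia : u - N ≤ N)
  refine (Real.le_norm_self _).trans ?_
  rw [← Complex.norm_real, hgauss, norm_mul, Complex.norm_real, Real.norm_of_nonneg (by positivity)]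
  refine mul_le_mul_of_nonneg_left ?_ (by positivity)
  rw [Finset.sum_Ico_sum_Ico_eq_diag_add]
  refine (norm_add_le _ _).trans (add_le_add hdiag ((norm_add_le _ _).trans ?_))
  linarith

lemma integrable_gaussian_mul_norm_sq_dirichletSum (N u : ℕ) (T h : ℝ) :
    MeasureTheory.Integrable
      fun x : ℝ => Real.exp (-x ^ 2) * ‖dirichletSum N u (T + h * x)‖ ^ 2 := by
  have hb : ∀ t, ‖dirichletSum N u t‖ ^ 2 ≤ ((u - N : ℕ) : ℝ) ^ 2 := by
    intro t
    refine pow_le_pow_left₀ (norm_nonneg _) ((norm_sum_le _ _).trans (le_of_eq ?_)) 2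
    have : ∀ n : ℕ, ‖cexp (-(t * Real.log n : ℝ) * I)‖ = 1 := by
      intro n; rw [← ofReal_neg, norm_exp_ofReal_mul_I]
    simp only [this, Finset.sum_const, Nat.card_Ico, nsmul_eq_mul, mul_one]
  refine ((integrable_exp_neg_mul_sq one_pos).mul_const (((u - N : ℕ) : ℝ) ^ 2)).mono'
    (by fun_prop) (Filter.Eventually.of_forall fun x => ?_)
  rw [Real.norm_of_nonneg (by positivity), neg_one_mul]
  exact mul_le_mul_of_nonneg_left (hb _) (by positivity)

lemma integral_norm_sq_dirichletSum_le {h ℓ : ℝ} {N u : ℕ} (hh : 1 ≤ h) (hℓ : 1 ≤ ℓ)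
    (hT : h ^ 3 = Real.exp ℓ) (hN : 1 ≤ N) (hNT : (N : ℝ) ≤ h ^ 3) (hu : u ≤ 2 * N) :
    ∫ x in (0 : ℝ)..1, ‖dirichletSum N u (h ^ 3 + h * x)‖ ^ 2 ≤ 4000000 * N * ℓ ^ 3 := by
  set f : ℝ → ℝ := fun x => ‖dirichletSum N u (h ^ 3 + h * x)‖ ^ 2 with hf
  have hgi : MeasureTheory.Integrable fun x => Real.exp (-x ^ 2) * f x :=
    integrable_gaussian_mul_norm_sq_dirichletSum N u (h ^ 3) h
  have hfc : Continuous f := by fun_prop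
  have h1 : ∫ x in (0 : ℝ)..1, f x ≤
      ∫ x in (0 : ℝ)..1, Real.exp 1 * (Real.exp (-x ^ 2) * f x) := by
    refine intervalIntegral.integral_mono_on zero_le_one (hfc.intervalIntegrable _ _)
      ((by fun_prop : Continuous fun x => Real.exp 1 * (Real.exp (-x ^ 2) * f x)).intervalIntegrable
        _ _) fun x hx => ?_
    rw [← mul_assoc, ← Real.exp_add]
    refine le_mul_of_one_le_left (by positivity) (Real.one_le_exp ?_)
    have := pow_le_one₀ hx.1 hx.2 (n := 2)
    linarith
  have h2 : ∫ x in (0 : ℝ)..1, Real.exp (-x ^ 2) * f x ≤ ∫ x, Real.exp (-x ^ 2) * f x := by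
    rw [intervalIntegral.integral_of_le zero_le_one]
    exact MeasureTheory.setIntegral_le_integral hgi
      (Filter.Eventually.of_forall fun x => by positivity)
  have h3 := integral_gaussian_mul_norm_sq_dirichletSum_le hh hℓ hT hN hNT hu
  rw [intervalIntegral.integral_const_mul] at h1
  have hN0 : (0 : ℝ) ≤ N := by positivity
  have hℓ3 : 1 ≤ ℓ ^ 3 := one_le_pow₀ hℓ
  have hpi : √Real.pi ≤ 2 := by
    rw [Real.sqrt_le_left two_pos.le]
    have := Real.pi_lt_four; linarith
  have he : Real.exp 1 ≤ 3 := by have := Real.exp_one_lt_d9; linarith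
  have h4 : (N : ℝ) + 2 * (500 * N * (8 * ℓ) ^ 3) ≤ 600000 * (N * ℓ ^ 3) := by
    nlinarith [mul_le_mul_of_nonneg_left hℓ3 hN0]
  calc ∫ x in (0 : ℝ)..1, f x ≤ Real.exp 1 * (√Real.pi * (N + 2 * (500 * N * (8 * ℓ) ^ 3))) :=
        h1.trans (mul_le_mul_of_nonneg_left (h2.trans h3) (Real.exp_pos _).le)
    _ ≤ 3 * (2 * (600000 * (N * ℓ ^ 3))) := by gcongr
    _ ≤ 4000000 * N * ℓ ^ 3 := by
        have : 0 ≤ N * ℓ ^ 3 := by positivity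
        nlinarith

section ZetaApproximation

open Filter Topology

/-- The difference between `n ^ (-s)` and the integral of `x ^ (-s)` over `[n, n + 1]`. -/
noncomputable def zetaRemainderTerm (n : ℕ) (s : ℂ) : ℂ :=
  (n : ℂ) ^ (-s) - (((n + 1 : ℕ) : ℂ) ^ (1 - s) - (n : ℂ) ^ (1 - s)) / (1 - s)

lemma norm_cpow_neg_sub_le {n : ℕ} (hn : 1 ≤ n) {s : ℂ} (hs : 0 < s.re) {y : ℝ}
    (hy : y ∈ Set.Icc (n : ℝ) (n + 1)) :
    ‖(n : ℂ) ^ (-s) - (y : ℂ) ^ (-s)‖ ≤ ‖s‖ * (n : ℝ) ^ (-s.re - 1) := by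
  have hn0 : (0 : ℝ) < n := by exact_mod_cast hn
  have hs0 : s ≠ 0 := by rintro rfl; simp at hs
  have hd : ∀ x ∈ Set.Icc (n : ℝ) (n + 1),
      HasDerivWithinAt (fun x : ℝ => (x : ℂ) ^ (-s)) (-s * (x : ℂ) ^ (-s - 1))
        (Set.Icc (n : ℝ) (n + 1)) x := by
    intro x hx
    have hx0 : x ≠ 0 := (hn0.trans_le hx.1).ne'
    exact (hasDerivAt_ofReal_cpow_const hx0 (neg_ne_zero.mpr hs0)).hasDerivWithinAt
  have hb : ∀ x ∈ Set.Ico (n : ℝ) (n + 1),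
      ‖-s * (x : ℂ) ^ (-s - 1)‖ ≤ ‖s‖ * (n : ℝ) ^ (-s.re - 1) := by
    intro x hx
    rw [norm_mul, norm_neg, norm_cpow_eq_rpow_re_of_pos (hn0.trans_le hx.1)]
    refine mul_le_mul_of_nonneg_left ?_ (norm_nonneg _)
    simpa using Real.rpow_le_rpow_of_nonpos hn0 hx.1 (by linarith : -s.re - 1 ≤ 0)
  have := norm_image_sub_le_of_norm_deriv_le_segment' hd hb y hy
  rw [norm_sub_rev]
  refine this.trans (mul_le_of_le_one_right (by positivity) (by linarith [hy.2]))

lemma norm_zetaRemainderTerm_le {n : ℕ} (hn : 1 ≤ n) {s : ℂ} (hs : 0 < s.re) (hs1 : s ≠ 1) :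
    ‖zetaRemainderTerm n s‖ ≤ ‖s‖ * (n : ℝ) ^ (-s.re - 1) := by
  have hn0 : (0 : ℝ) < n := by exact_mod_cast hn
  have hs1' : 1 - s ≠ 0 := sub_ne_zero.mpr hs1.symm
  have hd : ∀ x ∈ Set.Icc (n : ℝ) (n + 1),
      HasDerivWithinAt (fun x : ℝ => (x : ℂ) * (n : ℂ) ^ (-s) - (x : ℂ) ^ (1 - s) / (1 - s))
        ((n : ℂ) ^ (-s) - (x : ℂ) ^ (-s)) (Set.Icc (n : ℝ) (n + 1)) x := by
    intro x hx
    have hx0 : x ≠ 0 := (hn0.trans_le hx.1).ne'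
    have h1 := ((hasDerivAt_ofReal_cpow_const hx0 hs1').div_const (1 - s))
    have h2 := ((hasDerivAt_id x).ofReal_comp).mul_const ((n : ℂ) ^ (-s))
    refine ((h2.sub h1).congr_deriv ?_).hasDerivWithinAt
    rw [show (1 - s - 1 : ℂ) = -s by ring, mul_div_cancel_left₀ _ hs1', ofReal_one, one_mul]
  have hb : ∀ x ∈ Set.Ico (n : ℝ) (n + 1),
      ‖(n : ℂ) ^ (-s) - (x : ℂ) ^ (-s)‖ ≤ ‖s‖ * (n : ℝ) ^ (-s.re - 1) :=
    fun x hx => norm_cpow_neg_sub_le hn hs (Set.Ico_subset_Icc_self hx)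
  have := norm_image_sub_le_of_norm_deriv_le_segment' hd hb (n + 1) (by simp)
  rw [add_sub_cancel_left, mul_one] at this
  refine le_of_eq_of_le ?_ this
  congr 1
  simp only [zetaRemainderTerm]
  push_cast
  ring

lemma tsum_zetaRemainderTerm_eq {M : ℕ} (hM : 1 ≤ M) {s : ℂ} (hs : 1 < s.re) :
    ∑ n ∈ Finset.Ico 1 M, (n : ℂ) ^ (-s) + (M : ℂ) ^ (1 - s) / (s - 1) +
      ∑' n, zetaRemainderTerm (n + M) s = riemannZeta s := by
  have hs1 : s ≠ 1 := by rintro rfl; simp at hs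
  have hs1' : s - 1 ≠ 0 := sub_ne_zero.mpr hs1
  have hs1'' : 1 - s ≠ 0 := sub_ne_zero.mpr hs1.symm
  have hs0 : s ≠ 0 := by rintro rfl; norm_num at hs
  have hsum : Summable fun n : ℕ => (n : ℂ) ^ (-s) := by
    simpa [cpow_neg, one_div] using Complex.summable_one_div_nat_cpow.mpr hs
  have hz : riemannZeta s = ∑ n ∈ Finset.Ico 1 M, (n : ℂ) ^ (-s) +
      ∑' n : ℕ, ((n + M : ℕ) : ℂ) ^ (-s) := by
    rw [zeta_eq_tsum_one_div_nat_cpow hs]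
    simp_rw [one_div, ← cpow_neg]
    rw [← hsum.sum_add_tsum_nat_add M, Finset.range_eq_Ico,
      Finset.sum_eq_sum_Ico_succ_bot (by lia : 0 < M)]
    simp [hs0]
  have hrs : Summable fun n => zetaRemainderTerm (n + M) s := by
    have h1 : Summable fun n : ℕ => ‖s‖ * (n : ℝ) ^ (-s.re - 1) :=
      (Real.summable_nat_rpow.mpr (by linarith)).mul_left _
    exact ((summable_nat_add_iff M).mpr h1).of_norm_bounded
      fun n => norm_zetaRemainderTerm_le (by lia) (by linarith) hs1
  have hpart : ∀ K : ℕ, ∑ n ∈ Finset.range K, zetaRemainderTerm (n + M) s =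
      ∑ n ∈ Finset.range K, ((n + M : ℕ) : ℂ) ^ (-s) -
        (((K + M : ℕ) : ℂ) ^ (1 - s) - (M : ℂ) ^ (1 - s)) / (1 - s) := by
    intro K
    induction K with
    | zero => simp
    | succ K ih =>
      rw [Finset.sum_range_succ, Finset.sum_range_succ, ih, zetaRemainderTerm,
        show K + 1 + M = K + M + 1 by ring]
      ring
  have hlim0 : Tendsto (fun K : ℕ => ((K + M : ℕ) : ℂ) ^ (1 - s)) atTop (𝓝 0) := by
    rw [tendsto_zero_iff_norm_tendsto_zero]
    have h1 : Tendsto (fun K : ℕ => ((K + M : ℕ) : ℝ) ^ (-(s.re - 1))) atTop (𝓝 0) :=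
      ((tendsto_rpow_neg_atTop (by linarith : 0 < s.re - 1)).comp
        tendsto_natCast_atTop_atTop).comp (tendsto_add_atTop_nat M)
    refine h1.congr fun K => ?_
    rw [norm_natCast_cpow_of_pos (by lia)]
    congr 1; simp
  have h1 := hrs.hasSum.tendsto_sum_nat
  have h2 : Tendsto (fun K : ℕ => ∑ n ∈ Finset.range K, zetaRemainderTerm (n + M) s) atTop
      (𝓝 (∑' n : ℕ, ((n + M : ℕ) : ℂ) ^ (-s) - (0 - (M : ℂ) ^ (1 - s)) / (1 - s))) := by
    simp_rw [hpart]
    exact ((summable_nat_add_iff M).mpr hsum).hasSum.tendsto_sum_nat.sub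
      ((hlim0.sub_const _).div_const _)
  rw [tendsto_nhds_unique h1 h2, hz, show (s - 1) = -(1 - s) by ring]
  field_simp
  ring

lemma riemannZeta_eq_sum_add_tsum_zetaRemainderTerm {M : ℕ} (hM : 1 ≤ M) {s : ℂ}
    (hs : 0 < s.re) (hs' : 0 < s.im) :
    riemannZeta s = ∑ n ∈ Finset.Ico 1 M, (n : ℂ) ^ (-s) + (M : ℂ) ^ (1 - s) / (s - 1) +
      ∑' n, zetaRemainderTerm (n + M) s := by
  set ε := s.re / 2 with hε
  set R := ‖s‖ + 3 with hR
  set U : Set ℂ := {z | ε < z.re} ∩ {z | 0 < z.im} ∩ Metric.ball 0 R with hU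
  have hUo : IsOpen U :=
    ((isOpen_lt continuous_const continuous_re).inter
      (isOpen_lt continuous_const continuous_im)).inter Metric.isOpen_ball
  have hUc : Convex ℝ U :=
    ((convex_halfSpace_re_gt _).inter (convex_halfSpace_im_gt _)).inter (convex_ball _ _)
  have hne : ∀ z ∈ U, z ≠ 1 := by
    rintro z hz rfl
    simpa using hz.1.2
  have hM0 : (M : ℂ) ≠ 0 := by exact_mod_cast (by lia : M ≠ 0)
  have hcpow : ∀ n : ℕ, 1 ≤ n → ∀ f : ℂ → ℂ, Differentiable ℂ f →
      DifferentiableOn ℂ (fun z => (n : ℂ) ^ f z) U := by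
    intro n hn f hf
    exact (hf.const_cpow (Or.inl (by exact_mod_cast (by lia : n ≠ 0)))).differentiableOn
  have hε0 : 0 < ε := by rw [hε]; linarith
  have htail : DifferentiableOn ℂ (fun z => ∑' n, zetaRemainderTerm (n + M) z) U := by
    have hsum : Summable fun n : ℕ => R * ((n + M : ℕ) : ℝ) ^ (-ε - 1) :=
      ((summable_nat_add_iff M).mpr
        (Real.summable_nat_rpow.mpr (by linarith : -ε - 1 < -1))).mul_left _
    refine differentiableOn_tsum_of_summable_norm hsum (fun n => ?_) hUo fun n z hz => ?_
    · unfold zetaRemainderTerm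
      refine (hcpow _ (by lia) _ (by fun_prop)).sub
        (((hcpow _ (by lia) _ (by fun_prop)).sub (hcpow _ (by lia) _ (by fun_prop))).div
          (by fun_prop) fun z hz => sub_ne_zero.mpr (hne z hz).symm)
    · have hre : ε < z.re := hz.1.1
      have hzR : ‖z‖ < R := by simpa using hz.2
      refine (norm_zetaRemainderTerm_le (by lia) (by linarith) (hne z hz)).trans ?_
      refine mul_le_mul hzR.le ?_ (by positivity) (by positivity)
      exact Real.rpow_le_rpow_of_exponent_le (by exact_mod_cast (by lia : 1 ≤ n + M)) (by linarith)
  have hF : DifferentiableOn ℂ (fun z => ∑ n ∈ Finset.Ico 1 M, (n : ℂ) ^ (-z) +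
      (M : ℂ) ^ (1 - z) / (z - 1) + ∑' n, zetaRemainderTerm (n + M) z) U := by
    refine (DifferentiableOn.add ?_ ?_).add htail
    · refine DifferentiableOn.fun_sum fun n hn => hcpow n (Finset.mem_Ico.mp hn).1 _ (by fun_prop)
    · exact (hcpow M hM _ (by fun_prop)).div (by fun_prop) fun z hz => sub_ne_zero.mpr (hne z hz)
  have hζ : DifferentiableOn ℂ riemannZeta U := fun z hz =>
    (differentiableAt_riemannZeta (hne z hz)).differentiableWithinAt
  have hs2 : s + 2 ∈ U := by
    refine ⟨⟨?_, ?_⟩, ?_⟩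
    · simp only [Set.mem_ofPred_eq, add_re, re_ofNat]; linarith
    · simpa using hs'
    · rw [mem_ball_zero_iff]
      have := norm_add_le s 2
      rw [Complex.norm_ofNat] at this
      linarith
  have hsU : s ∈ U := by
    refine ⟨⟨?_, hs'⟩, ?_⟩
    · simp only [Set.mem_ofPred_eq]; linarith
    · rw [mem_ball_zero_iff]; linarith
  refine (hζ.analyticOnNhd hUo).eqOn_of_preconnected_of_eventuallyEq (hF.analyticOnNhd hUo)
    hUc.isPreconnected hs2 ?_ hsU
  have : ∀ᶠ z in 𝓝 (s + 2), 1 < z.re :=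
    (isOpen_lt continuous_const continuous_re).mem_nhds (by
      simp only [Set.mem_ofPred_eq, add_re, re_ofNat]; linarith)
  filter_upwards [this] with z hz using (tsum_zetaRemainderTerm_eq hM hz).symm

lemma rpow_neg_three_halves_le {k : ℕ} (hk : 1 ≤ k) :
    (k : ℝ) ^ (-(3 / 2) : ℝ) ≤ 4 * ((√(k : ℝ))⁻¹ - (√((k + 1 : ℕ) : ℝ))⁻¹) := by
  have hk0 : (0 : ℝ) < k := by exact_mod_cast hk
  set a := √(k : ℝ) with ha
  set b := √((k + 1 : ℕ) : ℝ) with hb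
  have ha0 : 0 < a := by positivity
  have hb0 : 0 < b := by positivity
  have ha2 : a ^ 2 = k := Real.sq_sqrt hk0.le
  have hb2 : b ^ 2 = k + 1 := by rw [hb, Real.sq_sqrt (by positivity)]; push_cast; rfl
  have ha1 : 1 ≤ a := by rw [ha, Real.one_le_sqrt]; exact_mod_cast hk
  have hpow : (k : ℝ) ^ (-(3 / 2) : ℝ) = (a ^ 3)⁻¹ := by
    rw [Real.rpow_neg hk0.le, ha, Real.sqrt_eq_rpow, ← Real.rpow_natCast, ← Real.rpow_mul hk0.le]
    norm_num
  have hdiff : a⁻¹ - b⁻¹ = (a * b * (a + b))⁻¹ := by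
    field_simp
    nlinarith
  rw [hpow, hdiff, ← div_eq_mul_inv, inv_eq_one_div, div_le_div_iff₀ (by positivity)
    (by positivity)]
  have hba : b ≤ 3 / 2 * a := by
    refine le_of_sq_le_sq ?_ (by positivity)
    nlinarith
  nlinarith [mul_le_mul hba hba hb0.le (by positivity), mul_pos ha0 ha0, mul_pos ha0 hb0]

lemma tsum_zetaRemainderTerm_norm_le {M : ℕ} (hM : 1 ≤ M) {s : ℂ} (hs : 1 / 2 ≤ s.re)
    (hs1 : s ≠ 1) : ‖∑' n, zetaRemainderTerm (n + M) s‖ ≤ 4 * ‖s‖ / √(M : ℝ) := by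
  have hsum : HasSum
      (fun n : ℕ => 4 * ‖s‖ * ((√((n + M : ℕ) : ℝ))⁻¹ - (√((n + 1 + M : ℕ) : ℝ))⁻¹))
      (4 * ‖s‖ * (√(M : ℝ))⁻¹) := by
    refine HasSum.mul_left _ ?_
    rw [hasSum_iff_tendsto_nat_of_nonneg]
    · simp_rw [Finset.sum_range_sub' fun n : ℕ => (√((n + M : ℕ) : ℝ))⁻¹]
      have : Tendsto (fun n : ℕ => (√((n + M : ℕ) : ℝ))⁻¹) atTop (𝓝 0) :=
        ((tendsto_inv_atTop_zero.comp Real.tendsto_sqrt_atTop).comp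
          tendsto_natCast_atTop_atTop).comp (tendsto_add_atTop_nat M)
      simpa using tendsto_const_nhds.sub this
    · intro n
      rw [sub_nonneg]
      refine inv_anti₀ (Real.sqrt_pos.mpr (by exact_mod_cast (by lia : 0 < n + M)))
        (Real.sqrt_le_sqrt (by exact_mod_cast (by lia : n + M ≤ n + 1 + M)))
  rw [div_eq_mul_inv]
  refine tsum_of_norm_bounded hsum fun n => ?_
  refine (norm_zetaRemainderTerm_le (by lia) (by linarith) hs1).trans ?_
  have h1 : ((n + M : ℕ) : ℝ) ^ (-s.re - 1) ≤ ((n + M : ℕ) : ℝ) ^ (-(3 / 2) : ℝ) :=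
    Real.rpow_le_rpow_of_exponent_le (by exact_mod_cast (by lia : 1 ≤ n + M)) (by linarith)
  have h2 := rpow_neg_three_halves_le (k := n + M) (by lia)
  rw [show n + M + 1 = n + 1 + M by ring] at h2
  nlinarith [mul_le_mul_of_nonneg_left (h1.trans h2) (norm_nonneg s)]

lemma norm_riemannZeta_le {M : ℕ} (hM : 1 ≤ M) {s : ℂ} (hs : 1 / 2 ≤ s.re) (hs' : 0 < s.im) :
    ‖riemannZeta s‖ ≤ ‖∑ n ∈ Finset.Ico 1 M, (n : ℂ) ^ (-s)‖ + √(M : ℝ) / s.im +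
      4 * ‖s‖ / √(M : ℝ) := by
  have hs1 : s ≠ 1 := by rintro rfl; simp at hs'
  rw [riemannZeta_eq_sum_add_tsum_zetaRemainderTerm hM (by linarith) hs']
  refine (norm_add_le _ _).trans (add_le_add ((norm_add_le _ _).trans ?_)
    (tsum_zetaRemainderTerm_norm_le hM hs hs1))
  gcongr
  rw [norm_div, norm_natCast_cpow_of_pos (by lia)]
  refine div_le_div₀ (by positivity) ?_ hs' ?_
  · rw [Real.sqrt_eq_rpow]
    exact Real.rpow_le_rpow_of_exponent_le (by exact_mod_cast hM) (by simp; linarith)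
  · simpa using (le_abs_self _).trans (Complex.abs_im_le_norm (s - 1))

end ZetaApproximation

lemma norm_dirichletSum_le_of_le_two_mul {N u : ℕ} {t : ℝ} (hN : 1 ≤ N) (hu : u ≤ 2 * N)
    (ht : 0 < t) (htN : t ≤ 2 * N) : ‖dirichletSum N u t‖ ≤ 40 * N / t := by
  have hN0 : (0 : ℝ) < N := by exact_mod_cast hN
  have hdiff : ∀ n : ℕ, 1 ≤ n →
      t * Real.log (n + 1 : ℕ) - t * Real.log n = t * Real.log (1 + 1 / n) := by
    intro n hn
    have hn0 : (0 : ℝ) < n := by exact_mod_cast hn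
    rw [← mul_sub, ← Real.log_div (by positivity) (by positivity)]
    congr 2; push_cast; field_simp
  have hconj : ‖dirichletSum N u t‖ =
      ‖∑ n ∈ Finset.Ico N u, cexp ((t * Real.log n : ℝ) * I)‖ := by
    rw [← Complex.norm_conj, dirichletSum, map_sum]
    congr 1
    refine Finset.sum_congr rfl fun n _ => ?_
    rw [← Complex.exp_conj]
    simp only [map_neg, map_mul, conj_ofReal, conj_I]
    congr 1; ring
  have hθ : t / (4 * N) ≤ 1 / 2 := by
    rw [div_le_iff₀ (by positivity)]; linarith
  have key := norm_sum_exp_le_of_antitone_diff (φ := fun n => t * Real.log n) (a := N) (b := u)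
    (θ := t / (4 * N)) (by positivity) ?_ ?_ ?_
  · rw [hconj]
    refine key.trans ?_
    rw [div_div_eq_mul_div]
    refine div_le_div_of_nonneg_right ?_ ht.le
    have := Real.pi_lt_d2
    nlinarith
  · intro n hn _
    have hn0 : (0 : ℝ) < n := by exact_mod_cast hN.trans hn
    rw [show n + 2 = n + 1 + 1 from rfl, hdiff (n + 1) (by lia), hdiff n (hN.trans hn)]
    refine mul_le_mul_of_nonneg_left (Real.log_le_log (by positivity) ?_) ht.le
    gcongr; simp
  · intro n hn hnu
    have hn0 : (0 : ℝ) < n := by exact_mod_cast hN.trans hn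
    have hn1 : (1 : ℝ) ≤ n := by exact_mod_cast hN.trans hn
    have hn2 : (n : ℝ) ≤ 2 * N := by exact_mod_cast (hnu.le.trans hu)
    rw [hdiff n (hN.trans hn), div_eq_mul_inv]
    refine mul_le_mul_of_nonneg_left (le_trans ?_ (half_le_log_one_add (by positivity) ?_)) ht.le
    · rw [inv_eq_one_div, div_div, div_le_div_iff₀ (by positivity)
    (by positivity)]
      linarith
    · rw [div_le_one hn0]; exact hn1
  · intro n hn hnu
    have hn0 : (0 : ℝ) < n := by exact_mod_cast hN.trans hn
    have hNn : (N : ℝ) ≤ n := by exact_mod_cast hn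
    rw [hdiff n (hN.trans hn)]
    have h1 : Real.log (1 + 1 / n) ≤ 1 / n := by
      have := Real.log_le_sub_one_of_pos (by positivity : (0 : ℝ) < 1 + 1 / n)
      linarith
    have h2 : t * Real.log (1 + 1 / n) ≤ 2 := by
      refine (mul_le_mul_of_nonneg_left h1 ht.le).trans ?_
      rw [mul_one_div, div_le_iff₀ hn0]; linarith
    have := Real.pi_gt_three
    linarith

lemma Finset.sum_Ico_mul_eq_by_parts (w z : ℕ → ℂ) {N K : ℕ} (hK : N ≤ K) :
    ∑ n ∈ Finset.Ico N K, w n * z n = w K * ∑ n ∈ Finset.Ico N K, z n +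
      ∑ u ∈ Finset.Ico N K, (w u - w (u + 1)) * ∑ n ∈ Finset.Ico N (u + 1), z n := by
  induction K, hK using Nat.le_induction with
  | base => simp
  | succ K hK ih =>
    have hz := Finset.sum_Ico_succ_top hK z
    rw [Finset.sum_Ico_succ_top hK, ih,
      Finset.sum_Ico_succ_top hK fun u => (w u - w (u + 1)) * ∑ n ∈ Finset.Ico N (u + 1), z n, hz]
    ring

/-- A majorant for `∑ n ^ (-σ - it)` over `N ≤ n < 2 * N`, uniform in `1 / 2 ≤ σ ≤ 2`, obtained by
partial summation. -/
noncomputable def dyadicMajorant (N : ℕ) (t : ℝ) : ℝ :=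
  (√(N : ℝ))⁻¹ * ‖dirichletSum N (2 * N) t‖ +
    2 * (N * √(N : ℝ))⁻¹ * ∑ u ∈ Finset.Ico N (2 * N), ‖dirichletSum N (u + 1) t‖

@[fun_prop]
lemma continuous_dyadicMajorant (N : ℕ) : Continuous (dyadicMajorant N) := by
  unfold dyadicMajorant; fun_prop

lemma norm_sum_cpow_le_dyadicMajorant {N : ℕ} (hN : 1 ≤ N) {σ t : ℝ} (hσ : 1 / 2 ≤ σ)
    (hσ2 : σ ≤ 2) :
    ‖∑ n ∈ Finset.Ico N (2 * N), (n : ℂ) ^ (-(σ + t * I : ℂ))‖ ≤ dyadicMajorant N t := by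
  have hN0 : (0 : ℝ) < N := by exact_mod_cast hN
  have hterm : ∀ n ∈ Finset.Ico N (2 * N), (n : ℂ) ^ (-(σ + t * I : ℂ)) =
      (n : ℂ) ^ (-σ : ℂ) * cexp (-(t * Real.log n : ℝ) * I) := by
    intro n hn
    have hn0 : (n : ℂ) ≠ 0 := by
      rw [Finset.mem_Ico] at hn
      exact_mod_cast (by lia : n ≠ 0)
    rw [neg_add, cpow_add _ _ hn0]
    congr 1
    rw [cpow_def_of_ne_zero hn0, ← natCast_log]
    congr 1
    push_cast; ring
  rw [Finset.sum_congr rfl hterm, Finset.sum_Ico_mul_eq_by_parts _ _ (by lia)]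
  refine (norm_add_le _ _).trans (add_le_add ?_ ?_)
  · rw [norm_mul]
    refine mul_le_mul_of_nonneg_right ?_ (norm_nonneg _)
    rw [norm_natCast_cpow_of_pos (by lia), Real.sqrt_eq_rpow, ← Real.rpow_neg hN0.le]
    have h1 : ((2 * N : ℕ) : ℝ) ^ (-σ : ℂ).re ≤ ((2 * N : ℕ) : ℝ) ^ (-(1 / 2) : ℝ) :=
      Real.rpow_le_rpow_of_exponent_le (by exact_mod_cast (by lia : 1 ≤ 2 * N))
        (by simp; linarith)
    exact h1.trans (Real.rpow_le_rpow_of_nonpos hN0 (by push_cast; linarith) (by norm_num))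
  · rw [Finset.mul_sum]
    refine (norm_sum_le _ _).trans (Finset.sum_le_sum fun u hu => ?_)
    rw [Finset.mem_Ico] at hu
    rw [norm_mul]
    refine mul_le_mul_of_nonneg_right ?_ (norm_nonneg _)
    have hu0 : (N : ℝ) ≤ u := by exact_mod_cast hu.1
    have h1 := norm_cpow_neg_sub_le (n := u) (by lia) (s := σ) (by simp; linarith) (y := u + 1)
      (by simp)
    have h2 : ((u : ℝ)) ^ (-(σ : ℂ).re - 1) ≤ (u : ℝ) ^ (-(3 / 2) : ℝ) :=
      Real.rpow_le_rpow_of_exponent_le (by exact_mod_cast (by lia : 1 ≤ u)) (by simp; linarith)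
    have h3 : (u : ℝ) ^ (-(3 / 2) : ℝ) ≤ (N * √(N : ℝ))⁻¹ := by
      refine (Real.rpow_le_rpow_of_nonpos hN0 hu0 (by norm_num)).trans (le_of_eq ?_)
      rw [Real.rpow_neg hN0.le, Real.sqrt_eq_rpow, ← Real.rpow_one_add' hN0.le (by norm_num)]
      norm_num
    have h4 : ‖(σ : ℂ)‖ ≤ 2 := by
      rw [norm_real, Real.norm_of_nonneg (by linarith)]; exact hσ2
    push_cast at h1 ⊢
    exact h1.trans (mul_le_mul h4 (h2.trans h3) (by positivity) (by norm_num))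

lemma dyadicMajorant_le_of_le_two_mul {N : ℕ} {t : ℝ} (hN : 1 ≤ N) (ht : 0 < t)
    (htN : t ≤ 2 * N) : dyadicMajorant N t ≤ 120 * √(N : ℝ) / t := by
  have hN0 : (0 : ℝ) < N := by exact_mod_cast hN
  have hs : √(N : ℝ) ^ 2 = N := Real.sq_sqrt hN0.le
  have hs0 : 0 < √(N : ℝ) := by positivity
  have h1 := norm_dirichletSum_le_of_le_two_mul hN le_rfl ht htN
  have h2 : ∑ u ∈ Finset.Ico N (2 * N), ‖dirichletSum N (u + 1) t‖ ≤ N * (40 * N / t) := by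
    refine (Finset.sum_le_card_nsmul _ _ (40 * N / t) fun u hu => ?_).trans (le_of_eq ?_)
    · rw [Finset.mem_Ico] at hu
      exact norm_dirichletSum_le_of_le_two_mul hN (by lia) ht htN
    · rw [Nat.card_Ico, nsmul_eq_mul, show 2 * N - N = N by lia]
  calc dyadicMajorant N t
      ≤ (√(N : ℝ))⁻¹ * (40 * N / t) + 2 * (N * √(N : ℝ))⁻¹ * (N * (40 * N / t)) :=
        add_le_add (mul_le_mul_of_nonneg_left h1 (by positivity))
          (mul_le_mul_of_nonneg_left h2 (by positivity))
    _ = 120 * √(N : ℝ) / t := by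
        field_simp
        nlinarith

lemma integral_norm_dirichletSum_le {h ℓ : ℝ} {N u : ℕ} (hh : 1 ≤ h) (hℓ : 1 ≤ ℓ)
    (hT : h ^ 3 = Real.exp ℓ) (hN : 1 ≤ N) (hNT : (N : ℝ) ≤ h ^ 3) (hu : u ≤ 2 * N) :
    ∫ x in (0 : ℝ)..1, ‖dirichletSum N u (h ^ 3 + h * x)‖ ≤ 2000001 * √(N : ℝ) * ℓ ^ 3 := by
  have hN0 : (0 : ℝ) < N := by exact_mod_cast hN
  have hs : √(N : ℝ) ^ 2 = N := Real.sq_sqrt hN0.le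
  have hs0 : 0 < √(N : ℝ) := by positivity
  have hsq := integral_norm_sq_dirichletSum_le hh hℓ hT hN hNT hu
  have hmono : ∫ x in (0 : ℝ)..1, ‖dirichletSum N u (h ^ 3 + h * x)‖ ≤
      ∫ x in (0 : ℝ)..1, (√(N : ℝ) / 2 +
        (2 * √(N : ℝ))⁻¹ * ‖dirichletSum N u (h ^ 3 + h * x)‖ ^ 2) := by
    refine intervalIntegral.integral_mono_on zero_le_one
      (Continuous.intervalIntegrable (by fun_prop) _ _)
      (Continuous.intervalIntegrable (by fun_prop) _ _) fun x _ => ?_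
    set y := ‖dirichletSum N u (h ^ 3 + h * x)‖
    have : √(N : ℝ) / 2 + (2 * √(N : ℝ))⁻¹ * y ^ 2 - y =
        (2 * √(N : ℝ))⁻¹ * (y - √(N : ℝ)) ^ 2 := by
      field_simp; ring
    have : 0 ≤ (2 * √(N : ℝ))⁻¹ * (y - √(N : ℝ)) ^ 2 := by positivity
    linarith
  refine hmono.trans ?_
  rw [intervalIntegral.integral_add (by simp)
    (Continuous.intervalIntegrable (by fun_prop) _ _), intervalIntegral.integral_const_mul,
    intervalIntegral.integral_const]
  have h1 := mul_le_mul_of_nonneg_left hsq (by positivity : 0 ≤ (2 * √(N : ℝ))⁻¹)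
  have h2 : (2 * √(N : ℝ))⁻¹ * (4000000 * N * ℓ ^ 3) = 2000000 * √(N : ℝ) * ℓ ^ 3 := by
    field_simp; rw [hs]; ring
  have h3 : √(N : ℝ) * 1 ≤ √(N : ℝ) * ℓ ^ 3 :=
    mul_le_mul_of_nonneg_left (one_le_pow₀ hℓ) hs0.le
  simp only [sub_zero, one_smul]
  nlinarith

lemma integral_dyadicMajorant_le {h ℓ : ℝ} {N : ℕ} (hh : 1 ≤ h) (hℓ : 1 ≤ ℓ)
    (hT : h ^ 3 = Real.exp ℓ) (hN : 1 ≤ N) (hNT : (N : ℝ) ≤ h ^ 3) :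
    ∫ x in (0 : ℝ)..1, dyadicMajorant N (h ^ 3 + h * x) ≤ 7000000 * ℓ ^ 3 := by
  have hN0 : (0 : ℝ) < N := by exact_mod_cast hN
  have hs0 : 0 < √(N : ℝ) := by positivity
  unfold dyadicMajorant
  rw [intervalIntegral.integral_add (Continuous.intervalIntegrable (by fun_prop) _ _)
    (Continuous.intervalIntegrable (by fun_prop) _ _), intervalIntegral.integral_const_mul,
    intervalIntegral.integral_const_mul, intervalIntegral.integral_finsetSum
    fun u _ => Continuous.intervalIntegrable (by fun_prop) _ _]
  have h1 := integral_norm_dirichletSum_le hh hℓ hT hN hNT le_rfl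
  have h2 : ∑ u ∈ Finset.Ico N (2 * N), ∫ x in (0 : ℝ)..1,
      ‖dirichletSum N (u + 1) (h ^ 3 + h * x)‖ ≤ N * (2000001 * √(N : ℝ) * ℓ ^ 3) := by
    refine (Finset.sum_le_card_nsmul _ _ (2000001 * √(N : ℝ) * ℓ ^ 3) fun u hu => ?_).trans
      (le_of_eq ?_)
    · rw [Finset.mem_Ico] at hu
      exact integral_norm_dirichletSum_le hh hℓ hT hN hNT (by lia)
    · rw [Nat.card_Ico, nsmul_eq_mul, show 2 * N - N = N by lia]
  refine (add_le_add (mul_le_mul_of_nonneg_left h1 (by positivity))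
    (mul_le_mul_of_nonneg_left h2 (by positivity))).trans ?_
  have : (√(N : ℝ))⁻¹ * (2000001 * √(N : ℝ) * ℓ ^ 3) +
      2 * (N * √(N : ℝ))⁻¹ * (N * (2000001 * √(N : ℝ) * ℓ ^ 3)) = 6000003 * ℓ ^ 3 := by
    field_simp; norm_num
  rw [this]
  have : 0 ≤ ℓ ^ 3 := by positivity
  linarith

lemma exists_mem_Icc_le_of_integral_le {f : ℝ → ℝ} (hf : Continuous f) {c : ℝ}
    (hc : ∫ x in (0 : ℝ)..1, f x ≤ c) : ∃ x ∈ Set.Icc (0 : ℝ) 1, f x ≤ c := by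
  by_contra! H
  have := intervalIntegral.integral_lt_integral_of_continuousOn_of_le_of_exists_lt
    (f := fun _ => c) zero_lt_one continuousOn_const hf.continuousOn
    (fun x hx => (H x (Set.Ioc_subset_Icc_self hx)).le) ⟨0, by simp, H 0 (by simp)⟩
  simp at this
  linarith

lemma Finset.sum_Ico_one_two_pow {M : Type*} [AddCommMonoid M] (f : ℕ → M) (J : ℕ) :
    ∑ n ∈ Finset.Ico 1 (2 ^ J), f n =
      ∑ j ∈ Finset.range J, ∑ n ∈ Finset.Ico (2 ^ j) (2 * 2 ^ j), f n := by
  induction J with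
  | zero => simp
  | succ J ih =>
    rw [Finset.sum_range_succ, ← ih, pow_succ',
      Finset.sum_Ico_consecutive _ Nat.one_le_two_pow (by lia)]

/-- Every interval `[T, T + T ^ (1 / 3)]` contains an ordinate at which `ζ` is at most a constant
times `(log T) ^ 4` throughout `1 / 2 ≤ σ ≤ 2`. -/
lemma exists_forall_norm_riemannZeta_le {h ℓ : ℝ} (hh : 1 ≤ h) (hℓ : 1 ≤ ℓ)
    (hT : h ^ 3 = Real.exp ℓ) :
    ∃ t ∈ Set.Icc (h ^ 3) (h ^ 3 + h), ∀ σ : ℝ, 1 / 2 ≤ σ → σ ≤ 2 →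
      ‖riemannZeta (σ + t * I)‖ ≤ 30000000 * ℓ ^ 4 := by
  set T := h ^ 3 with hTdef
  have hT1 : 1 ≤ T := one_le_pow₀ hh
  have hhT : h ≤ T := le_self_pow₀ hh (by norm_num)
  obtain ⟨n, hn, hn'⟩ := exists_nat_pow_near (one_le_pow₀ hT1 (n := 2)) (one_lt_two (α := ℝ))
  have hJ : ((n + 1 : ℕ) : ℝ) ≤ 4 * ℓ := by
    have h1 := Real.log_le_log (by positivity) hn
    rw [Real.log_pow, Real.log_pow, hT, Real.log_exp] at h1
    have h2 := Real.log_two_gt_d9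
    push_cast at h1 ⊢
    nlinarith
  set S := (Finset.range (n + 1)).filter fun j => ((2 ^ j : ℕ) : ℝ) ≤ T with hS
  set G : ℝ → ℝ := fun x => ∑ j ∈ S, dyadicMajorant (2 ^ j) (T + h * x) with hG
  have hGc : Continuous G := by fun_prop
  have hGi : ∫ x in (0 : ℝ)..1, G x ≤ 4 * ℓ * (7000000 * ℓ ^ 3) := by
    rw [hG, intervalIntegral.integral_finsetSum
      fun u _ => Continuous.intervalIntegrable (by fun_prop) _ _]
    refine (Finset.sum_le_card_nsmul _ _ (7000000 * ℓ ^ 3) fun j hj => ?_).trans ?_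
    · exact integral_dyadicMajorant_le hh hℓ hT Nat.one_le_two_pow (Finset.mem_filter.mp hj).2
    · rw [nsmul_eq_mul]
      refine mul_le_mul_of_nonneg_right (le_trans ?_ hJ) (by positivity)
      exact_mod_cast (Finset.card_filter_le _ _).trans (by simp)
  obtain ⟨x, hx, hGx⟩ := exists_mem_Icc_le_of_integral_le hGc hGi
  have ht : T ≤ T + h * x := le_add_of_nonneg_right (mul_nonneg (by linarith) hx.1)
  have ht' : T + h * x ≤ T + h := by nlinarith [hx.2]
  refine ⟨T + h * x, ⟨ht, ht'⟩, fun σ hσ hσ2 => ?_⟩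
  set t := T + h * x with htdef
  have hT0 : 0 < T := by linarith
  have ht0 : 0 < t := by linarith
  have hsqrt : ∀ j, j ≤ n → √(((2 ^ j : ℕ) : ℝ)) ≤ T := by
    intro j hj
    rw [Real.sqrt_le_left hT0.le]
    push_cast
    exact (pow_le_pow_right₀ one_le_two hj).trans hn
  have hlarge : ∑ j ∈ (Finset.range (n + 1)).filter (fun j => ¬ ((2 ^ j : ℕ) : ℝ) ≤ T),
      dyadicMajorant (2 ^ j) t ≤ 4 * ℓ * 120 := by
    refine (Finset.sum_le_card_nsmul _ _ 120 fun j hj => ?_).trans ?_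
    · rw [Finset.mem_filter, Finset.mem_range, not_le] at hj
      refine (dyadicMajorant_le_of_le_two_mul Nat.one_le_two_pow ht0 (by linarith)).trans ?_
      rw [div_le_iff₀ ht0]
      have := hsqrt j (by lia)
      linarith
    · rw [nsmul_eq_mul]
      refine mul_le_mul_of_nonneg_right (le_trans ?_ hJ) (by norm_num)
      exact_mod_cast (Finset.card_filter_le _ _).trans (by simp)
  have hsum : ‖∑ m ∈ Finset.Ico (1 : ℕ) (2 ^ (n + 1)), (m : ℂ) ^ (-(σ + t * I : ℂ))‖ ≤
      4 * ℓ * (7000000 * ℓ ^ 3) + 4 * ℓ * 120 := by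
    rw [Finset.sum_Ico_one_two_pow]
    refine (norm_sum_le _ _).trans ((Finset.sum_le_sum fun j _ =>
      norm_sum_cpow_le_dyadicMajorant Nat.one_le_two_pow hσ hσ2).trans ?_)
    rw [← Finset.sum_filter_add_sum_filter_not _ fun j => ((2 ^ j : ℕ) : ℝ) ≤ T]
    exact add_le_add hGx hlarge
  have hz := norm_riemannZeta_le (M := 2 ^ (n + 1)) Nat.one_le_two_pow (s := σ + t * I)
    (by simpa using hσ) (by simpa using ht0)
  have him : (σ + t * I : ℂ).im = t := by simp
  have hnorm : ‖(σ + t * I : ℂ)‖ ≤ 2 + 2 * T := by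
    refine (norm_add_le _ _).trans ?_
    rw [norm_mul, norm_I, norm_real, norm_real, Real.norm_of_nonneg (by linarith),
      Real.norm_of_nonneg ht0.le]
    linarith
  have hup : √((2 ^ (n + 1) : ℕ) : ℝ) ≤ 2 * T := by
    rw [Real.sqrt_le_left (by linarith)]
    push_cast
    rw [pow_succ]
    nlinarith
  have hlow : T ≤ √((2 ^ (n + 1) : ℕ) : ℝ) := by
    apply Real.le_sqrt_of_sq_le
    push_cast
    exact hn'.le
  have h1 : √((2 ^ (n + 1) : ℕ) : ℝ) / (σ + t * I : ℂ).im ≤ 2 := by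
    rw [him, div_le_iff₀ ht0]; linarith
  have h2 : 4 * ‖(σ + t * I : ℂ)‖ / √((2 ^ (n + 1) : ℕ) : ℝ) ≤ 16 := by
    rw [div_le_iff₀ (by linarith)]; linarith
  have h3 : ℓ ≤ ℓ ^ 4 := le_self_pow₀ hℓ (by norm_num)
  nlinarith

theorem stmt5 :
    ∃ C : ℝ, 0 < C ∧ ∃ T₀ : ℝ, 0 < T₀ ∧ ∀ T : ℝ, T₀ ≤ T →
      ∃ T' : ℝ, T' ∈ Set.Icc T (T + T ^ ((1 : ℝ) / 3)) ∧
        ∀ σ : ℝ, 1 / 2 ≤ σ → σ ≤ 2 →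
          ‖riemannZeta (↑σ + ↑T' * I)‖ ≤
            Real.exp (C * Real.log (Real.log T) ^ 2) := by
  refine ⟨22, by norm_num, Real.exp (Real.exp 1), Real.exp_pos _, fun T hT => ?_⟩
  have hT0 : 0 < T := (Real.exp_pos _).trans_le hT
  have hℓ : Real.exp 1 ≤ Real.log T := (Real.le_log_iff_exp_le hT0).mpr hT
  have hℓ0 : 0 < Real.log T := (Real.exp_pos _).trans_le hℓ
  have hL : 1 ≤ Real.log (Real.log T) := (Real.le_log_iff_exp_le hℓ0).mpr hℓ
  have hℓ1 : 1 ≤ Real.log T := (Real.one_le_exp zero_le_one).trans hℓ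
  have hh : 1 ≤ T ^ ((1 : ℝ) / 3) :=
    Real.one_le_rpow ((Real.one_le_exp (Real.exp_pos _).le).trans hT) (by norm_num)
  have hcube : (T ^ ((1 : ℝ) / 3)) ^ 3 = T := by
    rw [← Real.rpow_natCast, ← Real.rpow_mul hT0.le]; norm_num
  obtain ⟨t, ht, H⟩ := exists_forall_norm_riemannZeta_le hh hℓ1
    (by rw [hcube, Real.exp_log hT0])
  rw [hcube] at ht
  refine ⟨t, ht, fun σ hσ hσ2 => (H σ hσ hσ2).trans ?_⟩
  have hconst : (30000000 : ℝ) ≤ Real.exp 18 := by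
    have h1 : (2.7 : ℝ) ≤ Real.exp 1 := by have := Real.exp_one_gt_d9; linarith
    calc (30000000 : ℝ) ≤ 2.7 ^ 18 := by norm_num
      _ ≤ Real.exp 1 ^ 18 := pow_le_pow_left₀ (by norm_num) h1 18
      _ = Real.exp 18 := by rw [← Real.exp_nat_mul]; norm_num
  set L := Real.log (Real.log T) with hLdef
  have hpow : Real.log T ^ 4 = Real.exp (4 * L) := by
    rw [← Real.exp_log hℓ0, ← Real.exp_nat_mul]; norm_num [hLdef]
  calc 30000000 * Real.log T ^ 4 ≤ Real.exp 18 * Real.exp (4 * L) := by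
        rw [hpow]; exact mul_le_mul_of_nonneg_right hconst (Real.exp_pos _).le
    _ = Real.exp (18 + 4 * L) := (Real.exp_add _ _).symm
    _ ≤ Real.exp (22 * L ^ 2) := Real.exp_le_exp.mpr (by nlinarith)
end
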